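/- arXiv:1507.03033 — 10 statements merged into one kernel-verified Lean document; each statement's English description precedes it below -/
import Mathlib

section
/- Let 1 ≤ q < ∞, let P ⊆ S ⊆ F and R ⊆ G be subspaces such that the closed unit ball B_R = {g ∈ R : ‖g‖ ≤ 1} is compact in the topology τ_B(S), and let T : P → E be a (q,R)-summing operator with constant K. Then there exists a Borel probability measure η on the compact topological space (B_R, τ_B(S)) such that ‖T f‖ ≤ K · ( ∫_{B_R} ‖B(f, g)‖^q dη(g) )^{1/q} for every f ∈ P. -/
open scoped BigOperators
open MeasureTheory

noncomputable section

variable {F G X E : Type*}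
variable [NormedAddCommGroup F] [NormedSpace ℝ F] [CompleteSpace F]
variable [NormedAddCommGroup G] [NormedSpace ℝ G] [CompleteSpace G]
variable [NormedAddCommGroup X] [NormedSpace ℝ X] [CompleteSpace X]
variable [NormedAddCommGroup E] [NormedSpace ℝ E] [CompleteSpace E]

/-- The closed unit ball of a subspace `R`. -/
def subBall {H : Type*} [NormedAddCommGroup H] [NormedSpace ℝ H] (R : Submodule ℝ H) :
    Set H := {g | g ∈ R ∧ ‖g‖ ≤ 1}

/-- A continuous linear operator `T : P → E` is `(q,R)`-summing with respect to the
continuous bilinear map `B : F × G → X`, with constant `K`. -/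
def IsSumming (B : F →L[ℝ] G →L[ℝ] X) (P : Submodule ℝ F) (R : Submodule ℝ G)
    (q : ℝ) (T : P →L[ℝ] E) (K : ℝ) : Prop :=
  ∀ (n : ℕ) (f : Fin n → P),
    (∑ i, ‖T (f i)‖ ^ q) ^ (1 / q) ≤
      K * sSup ((fun g => (∑ i, ‖B (f i : F) g‖ ^ q) ^ (1 / q)) '' subBall R)

/-- `τ_B(S)`: the locally convex topology on `G` generated by the seminorms
`g ↦ ‖B(f,g)‖` for `f ∈ S`; equivalently, the topology induced by the map
`g ↦ (f ↦ B(f,g))` into the product space `S → X`. -/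
def tauB (B : F →L[ℝ] G →L[ℝ] X) (S : Submodule ℝ F) : TopologicalSpace G :=
  TopologicalSpace.induced (fun g => fun f : S => B (f : F) g) inferInstance

/-- The Borel σ-algebra on the unit ball of `R ⊆ G` for (the restriction of) the
topology `τ_B(S)`. -/
def ballBorel (B : F →L[ℝ] G →L[ℝ] X) (S : Submodule ℝ F) (R : Submodule ℝ G) :
    MeasurableSpace (subBall R) :=
  @borel _ (TopologicalSpace.induced (Subtype.val : subBall R → G) (tauB B S))

/-- A convex cone of continuous functions on a compact space, none of which is strictly positive,
is nonpositive for some normalized positive linear functional. -/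
theorem exists_positive_functional_nonpos {Y : Type*} [TopologicalSpace Y] [CompactSpace Y]
    (A : PointedCone ℝ C(Y, ℝ)) (hA : ∀ a ∈ A, ∃ y, a y ≤ 0) :
    ∃ L : C(Y, ℝ) →ₗ[ℝ] ℝ, (∀ h, 0 ≤ h → 0 ≤ L h) ∧ L 1 = 1 ∧ ∀ a ∈ A, L a ≤ 0 := by
  let O : Set C(Y, ℝ) := {h | Set.MapsTo h Set.univ (Set.Ioi 0)}
  have hOopen : IsOpen O := ContinuousMap.isOpen_setOfPred_mapsTo isCompact_univ isOpen_Ioi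
  have hOconv : Convex ℝ O := by
    intro h₁ h₁O h₂ h₂O a b ha hb hab y hy
    exact convex_Ioi (0 : ℝ) (h₁O hy) (h₂O hy) ha hb hab
  have hdisj : Disjoint O (A : Set C(Y, ℝ)) := by
    rw [Set.disjoint_left]
    intro h hO hmem
    obtain ⟨y, hy⟩ := hA h hmem
    exact absurd (hO (Set.mem_univ y)) (not_lt.2 hy)
  obtain ⟨l, u, hlO, hlA⟩ :=
    geometric_hahn_banach_open hOconv hOopen A.toConvexCone.convex hdisj
  have hu : u ≤ 0 := by simpa using hlA 0 A.zero_mem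
  have hlneg : ∀ h ∈ O, l h < 0 := fun h hh => (hlO h hh).trans_le hu
  have hone : l 1 < 0 := hlneg 1 fun y _ => by simp
  have hlnonpos : ∀ h, 0 ≤ h → l h ≤ 0 := by
    intro h hh
    have key : ∀ ε : ℝ, 0 < ε → l h + ε * l 1 < 0 := by
      intro ε hε
      have hmem : h + ε • (1 : C(Y, ℝ)) ∈ O := fun y _ => by
        have : 0 ≤ h y := hh y
        simp only [ContinuousMap.add_apply, ContinuousMap.smul_apply, ContinuousMap.one_apply,
          smul_eq_mul, mul_one, Set.mem_Ioi]
        linarith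
      simpa using hlneg _ hmem
    by_contra! hpos
    have := key (l h / -l 1) (div_pos hpos (neg_pos.2 hone))
    rw [div_neg, neg_mul, div_mul_cancel₀ _ hone.ne] at this
    linarith
  have hlAnonneg : ∀ a ∈ A, 0 ≤ l a := by
    intro a ha
    by_contra! hneg
    have h := hlA _ (A.smul_mem (div_nonneg_of_nonpos (a := u - 1) (by linarith) hneg.le) ha)
    rw [map_smul, smul_eq_mul, div_mul_cancel₀ _ hneg.ne] at h
    linarith
  refine ⟨(l 1)⁻¹ • l.toLinearMap, fun h hh => ?_, ?_, fun a ha => ?_⟩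
  · exact mul_nonneg_of_nonpos_of_nonpos (inv_nonpos.2 hone.le) (hlnonpos h hh)
  · exact inv_mul_cancel₀ hone.ne
  · exact mul_nonpos_of_nonpos_of_nonneg (inv_nonpos.2 hone.le) (hlAnonneg a ha)

/-- Riesz–Markov–Kakutani on a compact Hausdorff space, for normalized functionals. -/
theorem exists_isProbabilityMeasure_integral_eq_of_t2 {Y : Type*} [TopologicalSpace Y]
    [CompactSpace Y] [T2Space Y] [MeasurableSpace Y] [BorelSpace Y] (L : C(Y, ℝ) →ₗ[ℝ] ℝ)
    (hL : ∀ h, 0 ≤ h → 0 ≤ L h) (hL1 : L 1 = 1) :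
    ∃ μ : Measure Y, IsProbabilityMeasure μ ∧ ∀ f : C(Y, ℝ), ∫ y, f y ∂μ = L f := by
  let Λ : CompactlySupportedContinuousMap Y ℝ →ₚ[ℝ] ℝ := PositiveLinearMap.mk₀
    { toFun := fun f => L f.toContinuousMap
      map_add' := fun f g => map_add L f.toContinuousMap g.toContinuousMap
      map_smul' := fun c f => map_smul L c f.toContinuousMap }
    fun f hf => hL f.toContinuousMap hf
  have hint (f : C(Y, ℝ)) : ∫ y, f y ∂(RealRMK.rieszMeasure Λ) = L f :=
    RealRMK.integral_rieszMeasure Λ (CompactlySupportedContinuousMap.continuousMapEquiv f)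
  refine ⟨RealRMK.rieszMeasure Λ, ⟨?_⟩, hint⟩
  have h := hint 1
  rw [hL1] at h
  simpa [Measure.real, ENNReal.toReal_eq_one_iff] using h

/-- Riesz–Markov–Kakutani (existence) on a compact `R1Space`, for normalized functionals. -/
theorem exists_isProbabilityMeasure_integral_eq {Y : Type*} [TopologicalSpace Y]
    [CompactSpace Y] [R1Space Y] [MeasurableSpace Y] [BorelSpace Y] (L : C(Y, ℝ) →ₗ[ℝ] ℝ)
    (hL : ∀ h, 0 ≤ h → 0 ≤ L h) (hL1 : L 1 = 1) :
    ∃ μ : Measure Y, IsProbabilityMeasure μ ∧ ∀ f : C(Y, ℝ), ∫ y, f y ∂μ = L f := by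
  borelize (SeparationQuotient Y)
  have : CompactSpace (SeparationQuotient Y) := inferInstanceAs (CompactSpace (Quotient _))
  let mk : C(Y, SeparationQuotient Y) := ⟨SeparationQuotient.mk, SeparationQuotient.continuous_mk⟩
  let out : SeparationQuotient Y → Y := Function.surjInv SeparationQuotient.surjective_mk
  have hmk_out : ∀ z, SeparationQuotient.mk (out z) = z :=
    Function.surjInv_eq SeparationQuotient.surjective_mk
  have hout : Continuous out :=
    SeparationQuotient.isInducing_mk.continuous_iff.2 <| by
      simpa only [Function.comp_def, hmk_out] using continuous_id'
  obtain ⟨μ, hμ, hint⟩ := exists_isProbabilityMeasure_integral_eq_of_t2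
    (L.comp (ContinuousMap.compRightAlgHom ℝ ℝ mk).toLinearMap)
    (fun h hh => hL _ fun y => hh (mk y)) hL1
  refine ⟨μ.map out, Measure.isProbabilityMeasure_map hout.aemeasurable, fun f => ?_⟩
  rw [integral_map hout.aemeasurable f.continuous.measurable.aestronglyMeasurable]
  refine (hint (f.comp ⟨out, hout⟩)).trans (congrArg L (ContinuousMap.ext fun y => ?_))
  exact ((SeparationQuotient.mk_eq_mk.1 (hmk_out (SeparationQuotient.mk y))).map f.continuous).eq

/-- A convex cone of continuous functions on a compact `R1Space`, none of which is strictly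
positive, has nonpositive integrals with respect to some Borel probability measure. -/
theorem exists_isProbabilityMeasure_integral_nonpos {Y : Type*} [TopologicalSpace Y]
    [CompactSpace Y] [R1Space Y] [MeasurableSpace Y] [BorelSpace Y]
    (A : PointedCone ℝ C(Y, ℝ)) (hA : ∀ a ∈ A, ∃ y, a y ≤ 0) :
    ∃ μ : Measure Y, IsProbabilityMeasure μ ∧ ∀ a ∈ A, ∫ y, a y ∂μ ≤ 0 := by
  obtain ⟨L, hL, hL1, hLA⟩ := exists_positive_functional_nonpos A hA
  obtain ⟨μ, hμ, hint⟩ := exists_isProbabilityMeasure_integral_eq L hL hL1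
  exact ⟨μ, hμ, fun a ha => (hint a).trans_le (hLA a ha)⟩

/-- Abstract Pietsch domination: if `φ` and `c` are positively homogeneous of degree `q` and every
finite sum of the functions `c v - φ v` is somewhere nonpositive, then `c v ≤ ∫ φ v` for some Borel
probability measure. -/
theorem exists_isProbabilityMeasure_le_integral {V Y : Type*} [AddCommGroup V] [Module ℝ V]
    [TopologicalSpace Y] [CompactSpace Y] [R1Space Y] [MeasurableSpace Y] [BorelSpace Y]
    {q : ℝ} (hq : 0 < q) (φ : V → C(Y, ℝ)) (c : V → ℝ)
    (hφ : ∀ t : ℝ, 0 ≤ t → ∀ v, φ (t • v) = t ^ q • φ v)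
    (hc : ∀ t : ℝ, 0 ≤ t → ∀ v, c (t • v) = t ^ q * c v)
    (H : ∀ (n : ℕ) (v : Fin n → V), ∃ y, ∑ i, c (v i) ≤ ∑ i, φ (v i) y) :
    ∃ μ : Measure Y, IsProbabilityMeasure μ ∧ ∀ v, c v ≤ ∫ y, φ v y ∂μ := by
  let ψ (v : V) : C(Y, ℝ) := .const Y (c v) - φ v
  have hψ (t : ℝ) (ht : 0 ≤ t) (v : V) : ψ (t • v) = t ^ q • ψ v := by
    ext y
    simp [ψ, hφ t ht, hc t ht, mul_sub]
  let A : PointedCone ℝ C(Y, ℝ) :=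
    { carrier := {a | ∃ (n : ℕ) (v : Fin n → V), a = ∑ i, ψ (v i)}
      zero_mem' := ⟨0, Fin.elim0, by simp⟩
      add_mem' := by
        rintro _ _ ⟨m, v, rfl⟩ ⟨n, w, rfl⟩
        exact ⟨m + n, Fin.append v w, by simp [Fin.sum_univ_add]⟩
      smul_mem' := by
        rintro ⟨t, ht⟩ _ ⟨n, v, rfl⟩
        refine ⟨n, fun i => t ^ q⁻¹ • v i, ?_⟩
        simp only [hψ _ (Real.rpow_nonneg ht _), Real.rpow_inv_rpow ht hq.ne', ← Finset.smul_sum]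
        rfl }
  obtain ⟨μ, hμ, hμA⟩ := exists_isProbabilityMeasure_integral_nonpos A <| by
    rintro _ ⟨n, v, rfl⟩
    obtain ⟨y, hy⟩ := H n v
    exact ⟨y, by simpa [ψ] using hy⟩
  refine ⟨μ, hμ, fun v => ?_⟩
  have hint : Integrable (φ v) μ :=
    (φ v).continuous.integrable_of_hasCompactSupport (.of_compactSpace _)
  have h := hμA (ψ v) ⟨1, fun _ => v, by simp⟩
  simp only [ψ, ContinuousMap.sub_apply, ContinuousMap.const_apply] at h
  rw [integral_sub (integrable_const _) hint] at h
  simpa using h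


/-- Pietsch-type domination: if `P ⊆ S ⊆ F`, the closed unit ball `B_R` of `R ⊆ G` is
compact for the topology `τ_B(S)`, and `T : P → E` is `(q,R)`-summing with constant `K`,
then there is a Borel probability measure `η` on the compact space `(B_R, τ_B(S))` with
`‖T f‖ ≤ K · (∫_{B_R} ‖B(f,g)‖^q dη(g))^(1/q)` for every `f ∈ P`. -/
theorem pietsch_domination (B : F →L[ℝ] G →L[ℝ] X) (P S : Submodule ℝ F)
    (R : Submodule ℝ G) (q K : ℝ) (hq : 1 ≤ q) (hK : 0 ≤ K) (hPS : P ≤ S)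
    (hcomp : @IsCompact G (tauB B S) (subBall R))
    (T : P →L[ℝ] E) (hT : IsSumming B P R q T K) :
    ∃ η : @Measure (subBall R) (ballBorel B S R),
      @IsProbabilityMeasure _ (ballBorel B S R) η ∧
      ∀ f : P, ‖T f‖ ≤ K * (∫ g : subBall R, ‖B (f : F) (g : G)‖ ^ q ∂η) ^ (1 / q) := by
  have hq0 : 0 < q := by linarith
  let _ : TopologicalSpace (subBall R) :=
    TopologicalSpace.induced (Subtype.val : subBall R → G) (tauB B S)
  let _ : MeasurableSpace (subBall R) := ballBorel B S R
  have : BorelSpace (subBall R) := ⟨rfl⟩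
  have : CompactSpace (subBall R) :=
    @isCompact_iff_compactSpace G (tauB B S) (subBall R) |>.1 hcomp
  have : R1Space (subBall R) :=
    let _ := tauB B S
    have : R1Space G := .induced _
    .induced _
  have hcont (f : P) : Continuous fun g : subBall R => B (f : F) (g : G) :=
    (continuous_apply (⟨f, hPS f.2⟩ : S)).comp
      (@Continuous.comp _ _ _ _ (tauB B S) _ _ _
        (@continuous_induced_dom G (S → X) (fun g f => B (f : F) g) Pi.topologicalSpace)
        (@continuous_induced_dom (subBall R) G Subtype.val (tauB B S)))
  have hcontq (f : P) : Continuous fun g : subBall R => ‖B (f : F) (g : G)‖ ^ q :=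
    (hcont f).norm.rpow_const fun _ => .inr hq0.le
  have hne : Nonempty (subBall R) := ⟨⟨0, R.zero_mem, by simp⟩⟩
  obtain ⟨η, hη, hle⟩ := exists_isProbabilityMeasure_le_integral (V := P) (Y := subBall R) hq0
    (fun f => ⟨fun g => K ^ q * ‖B (f : F) (g : G)‖ ^ q, continuous_const.mul (hcontq f)⟩)
    (fun f => ‖T f‖ ^ q)
    (fun t ht f => by
      ext g
      simp [norm_smul, abs_of_nonneg ht, Real.mul_rpow ht]
      ring)
    (fun t ht f => by
      simp [norm_smul, abs_of_nonneg ht, Real.mul_rpow ht])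
    (fun n f => by
      have hsum (g : G) : 0 ≤ ∑ i, ‖B (f i : F) g‖ ^ q := by positivity
      obtain ⟨g₀, -, hg₀⟩ := isCompact_univ.exists_isMaxOn Set.univ_nonempty
        (continuous_finsetSum Finset.univ fun i _ => hcontq (f i)).continuousOn
      have hsup : sSup ((fun g => (∑ i, ‖B (f i : F) g‖ ^ q) ^ (1 / q)) '' subBall R) ≤
          (∑ i, ‖B (f i : F) (g₀ : G)‖ ^ q) ^ (1 / q) := by
        refine csSup_le (Set.Nonempty.image _ (Set.nonempty_coe_sort.1 hne)) ?_
        rintro _ ⟨g, hg, rfl⟩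
        exact Real.rpow_le_rpow (hsum g) (hg₀ (Set.mem_univ (⟨g, hg⟩ : subBall R)))
          (by positivity)
      have h := (hT n f).trans (mul_le_mul_of_nonneg_left hsup hK)
      refine ⟨g₀, ?_⟩
      have h' := Real.rpow_le_rpow (by positivity) h hq0.le
      rw [Real.mul_rpow hK (by positivity), one_div, Real.rpow_inv_rpow (by positivity) hq0.ne',
        Real.rpow_inv_rpow (hsum _) hq0.ne'] at h'
      simpa [Finset.mul_sum] using h')
  refine ⟨η, hη, fun f => ?_⟩
  have h : ‖T f‖ ^ q ≤ K ^ q * ∫ g : subBall R, ‖B (f : F) (g : G)‖ ^ q ∂η := by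
    rw [← integral_const_mul]
    exact hle f
  have hint : 0 ≤ ∫ g : subBall R, ‖B (f : F) (g : G)‖ ^ q ∂η :=
    integral_nonneg fun g => by positivity
  rw [← Real.rpow_le_rpow_iff (norm_nonneg _) (by positivity) hq0,
    Real.mul_rpow hK (by positivity), one_div, Real.rpow_inv_rpow hint hq0.ne']
  exact h
end
end

section
/- Let 1 ≤ q < ∞, let P ⊆ S ⊆ F and R ⊆ G be subspaces such that the closed unit ball B_R = {g ∈ R : ‖g‖ ≤ 1} is compact in the topology τ_B(S), and let T : P → E be a (q,R)-summing operator. Then T is τ_B(R)-sequentially completely continuous: for every norm-bounded sequence (f_n) in P such that lim_n ‖B(f_n, g)‖ = 0 for every g ∈ R, one has lim_n ‖T f_n‖ = 0. -/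
open scoped BigOperators
open Filter Topology

noncomputable section

variable {F G X E : Type*}
variable [NormedAddCommGroup F] [NormedSpace ℝ F] [CompleteSpace F]
variable [NormedAddCommGroup G] [NormedSpace ℝ G] [CompleteSpace G]
variable [NormedAddCommGroup X] [NormedSpace ℝ X] [CompleteSpace X]
variable [NormedAddCommGroup E] [NormedSpace ℝ E] [CompleteSpace E]

/-- A uniformly bounded sequence of continuous functions on a compact space converging pointwise to
zero has convex combinations that are uniformly as small as desired. -/
theorem exists_mem_convexHull_range_forall_lt {Y : Type*} [TopologicalSpace Y] [CompactSpace Y]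
    [T2Space Y] (h : ℕ → C(Y, ℝ)) {C : ℝ} (hC : ∀ n y, |h n y| ≤ C)
    (hlim : ∀ y, Tendsto (fun n => h n y) atTop (𝓝 0)) {ε : ℝ} (hε : 0 < ε) :
    ∃ u ∈ convexHull ℝ (Set.range h), ∀ y, u y < ε := by
  by_contra! hcon
  let U : Set C(Y, ℝ) := {u | ∀ y, u y < ε}
  have hUo : IsOpen U := by
    have := ContinuousMap.isOpen_setOfPred_mapsTo (X := Y) (Y := ℝ) isCompact_univ (isOpen_Iio (a := ε))
    simpa [Set.MapsTo, U] using this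
  have hUc : Convex ℝ U := fun u hu v hv a b ha hb hab y =>
    convex_Iio ε (hu y) (hv y) ha hb hab
  obtain ⟨φ, s, hφU, hφh⟩ := geometric_hahn_banach_open hUc hUo
    (convex_convexHull ℝ (Set.range h)) (Set.disjoint_left.2 fun u hu hu' => by
      obtain ⟨y, hy⟩ := hcon u hu'
      exact absurd (hu y) (not_lt.2 hy))
  have hs : 0 < s := by simpa using hφU 0 (fun _ => hε)
  have hpos : ∀ v : C(Y, ℝ), (∀ y, 0 ≤ v y) → 0 ≤ φ v := by
    intro v hv
    by_contra! hneg
    have h1 := hφU ((s / φ v) • v) fun y => by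
      have := mul_nonpos_of_nonpos_of_nonneg (div_nonpos_of_nonneg_of_nonpos hs.le hneg.le) (hv y)
      simpa using this.trans_lt hε
    rw [map_smul, smul_eq_mul, div_mul_cancel₀ _ hneg.ne] at h1
    exact h1.false
  let Λ₀ : CompactlySupportedContinuousMap Y ℝ →ₗ[ℝ] ℝ :=
    { toFun := fun v => φ v.toContinuousMap
      map_add' := fun v w => map_add φ v.toContinuousMap w.toContinuousMap
      map_smul' := fun c v => map_smul φ c v.toContinuousMap }
  let Λ : CompactlySupportedContinuousMap Y ℝ →ₚ[ℝ] ℝ :=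
    PositiveLinearMap.mk₀ Λ₀ fun v hv => hpos _ hv
  let _ : MeasurableSpace Y := borel Y
  have : BorelSpace Y := ⟨rfl⟩
  have hrep : ∀ v : C(Y, ℝ), ∫ y, v y ∂(RealRMK.rieszMeasure Λ) = φ v := fun v =>
    RealRMK.integral_rieszMeasure Λ (CompactlySupportedContinuousMap.continuousMapEquiv v)
  have hint : Tendsto (fun n => ∫ y, h n y ∂(RealRMK.rieszMeasure Λ)) atTop
      (𝓝 (∫ _, (0 : ℝ) ∂(RealRMK.rieszMeasure Λ))) :=
    MeasureTheory.tendsto_integral_of_dominated_convergence (fun _ => C)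
      (fun n => (h n).continuous.aestronglyMeasurable) (MeasureTheory.integrable_const C)
      (fun n => .of_forall fun y => hC n y) (.of_forall hlim)
  simp only [hrep, MeasureTheory.integral_zero] at hint
  exact hs.not_ge (ge_of_tendsto' hint fun n => hφh _ (subset_convexHull ℝ _ ⟨n, rfl⟩))

omit [CompleteSpace F] [CompleteSpace G] [CompleteSpace X] [CompleteSpace E] in
/-- The `(q,R)`-summing inequality for weighted finite families. -/
theorem IsSumming.le_of_forall_weighted_sum_le {B : F →L[ℝ] G →L[ℝ] X} {P : Submodule ℝ F}
    {R : Submodule ℝ G} {q K : ℝ} {T : P →L[ℝ] E} (hT : IsSumming B P R q T K) (hq : 1 ≤ q)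
    (hK : 0 ≤ K) {ι : Type*} (t : Finset ι) (w : ι → ℝ) (hw : ∀ i ∈ t, 0 ≤ w i) (f : ι → P)
    {ε : ℝ} (hε : 0 ≤ ε)
    (hle : ∀ g ∈ subBall R, ∑ i ∈ t, w i * ‖B (f i : F) g‖ ^ q ≤ ε ^ q) :
    (∑ i ∈ t, w i * ‖T (f i)‖ ^ q) ^ (1 / q) ≤ K * ε := by
  have hq0 : 0 < q := zero_lt_one.trans_le hq
  have hscale : ∀ i ∈ t, ∀ r : ℝ, 0 ≤ r → (w i ^ (1 / q) * r) ^ q = w i * r ^ q := by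
    intro i hi r hr
    rw [Real.mul_rpow (Real.rpow_nonneg (hw i hi) _) hr, ← Real.rpow_mul (hw i hi),
      one_div_mul_cancel hq0.ne', Real.rpow_one]
  have hnorm : ∀ i ∈ t, |w i ^ (1 / q)| = w i ^ (1 / q) := fun i hi =>
    abs_of_nonneg (Real.rpow_nonneg (hw i hi) _)
  have hreindex : ∀ a : ι → ℝ, ∑ k, a (t.equivFin.symm k) = ∑ i ∈ t, a i := fun a => by
    rw [← Finset.sum_coe_sort t, ← t.equivFin.symm.sum_comp]
  have key := hT t.card fun k => w (t.equivFin.symm k) ^ (1 / q) • f (t.equivFin.symm k)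
  rw [hreindex (fun i => ‖T (w i ^ (1 / q) • f i)‖ ^ q)] at key
  rw [Finset.sum_congr rfl fun i hi => show ‖T (w i ^ (1 / q) • f i)‖ ^ q = w i * ‖T (f i)‖ ^ q by
    rw [map_smul, norm_smul, Real.norm_eq_abs, hnorm i hi, hscale i hi _ (norm_nonneg _)]] at key
  refine key.trans (mul_le_mul_of_nonneg_left (Real.sSup_le ?_ hε) hK)
  rintro _ ⟨g, hg, rfl⟩
  beta_reduce
  rw [hreindex (fun i => ‖B ((w i ^ (1 / q) • f i : P) : F) g‖ ^ q)]
  rw [Finset.sum_congr rfl fun i hi => show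
    ‖B ((w i ^ (1 / q) • f i : P) : F) g‖ ^ q = w i * ‖B (f i : F) g‖ ^ q by
      rw [Submodule.coe_smul, map_smul, smul_apply, norm_smul,
        Real.norm_eq_abs, hnorm i hi, hscale i hi _ (norm_nonneg _)]]
  calc _ ≤ (ε ^ q) ^ (1 / q) := Real.rpow_le_rpow
        (Finset.sum_nonneg fun i hi => mul_nonneg (hw i hi) (by positivity)) (hle g hg)
        (by positivity)
    _ = ε := by rw [← Real.rpow_mul hε, mul_one_div_cancel hq0.ne', Real.rpow_one]

/-- If `P ⊆ S ⊆ F`, the closed unit ball of `R ⊆ G` is compact for the topology `τ_B(S)`,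
and `T : P → E` is `(q,R)`-summing, then `T` is `τ_B(R)`-sequentially completely
continuous: `‖T f_n‖ → 0` for every norm-bounded sequence `(f_n)` in `P` with
`‖B(f_n, g)‖ → 0` for all `g ∈ R`. -/
theorem summing_seq_completely_continuous (B : F →L[ℝ] G →L[ℝ] X) (P S : Submodule ℝ F)
    (R : Submodule ℝ G) (q : ℝ) (hq : 1 ≤ q) (hPS : P ≤ S)
    (hcomp : @IsCompact G (tauB B S) (subBall R))
    (T : P →L[ℝ] E) (hT : ∃ K, 0 ≤ K ∧ IsSumming B P R q T K) :
    ∀ f : ℕ → P, (∃ C, ∀ n, ‖f n‖ ≤ C) →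
      (∀ g ∈ R, Tendsto (fun n => ‖B ((f n : F)) g‖) atTop (𝓝 0)) →
      Tendsto (fun n => ‖T (f n)‖) atTop (𝓝 0) := by
  rintro f ⟨C, hC⟩ hlim
  obtain ⟨K, hK, hT⟩ := hT
  have hq0 : 0 < q := zero_lt_one.trans_le hq
  by_contra hnot
  obtain ⟨δ, hδ, hfreq⟩ : ∃ δ > 0, ∃ᶠ n in atTop, δ ≤ ‖T (f n)‖ := by
    simpa [Metric.tendsto_nhds, Filter.frequently_atTop] using hnot
  obtain ⟨σ, hσ, hδσ⟩ := extraction_of_frequently_atTop hfreq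
  let Φ : G → S → X := fun g s => B (s : F) g
  have hΦ : IsCompact (Φ '' subBall R) :=
    @IsCompact.image G (S → X) (tauB B S) _ _ _ hcomp continuous_induced_dom
  have : CompactSpace (Φ '' subBall R) := isCompact_iff_compactSpace.1 hΦ
  let h : ℕ → C(Φ '' subBall R, ℝ) := fun n =>
    { toFun := fun y => ‖(y : S → X) ⟨f (σ n), hPS (f (σ n)).2⟩‖ ^ q
      continuous_toFun := ((continuous_apply _).comp continuous_subtype_val).norm.rpow_const
        fun _ => Or.inr hq0.le }
  have hbound : ∀ n y, |h n y| ≤ (‖B‖ * C) ^ q := by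
    rintro n ⟨_, g, hg, rfl⟩
    change |‖B (f (σ n) : F) g‖ ^ q| ≤ _
    rw [abs_of_nonneg (by positivity)]
    refine Real.rpow_le_rpow (norm_nonneg _) ?_ hq0.le
    calc ‖B (f (σ n) : F) g‖ ≤ ‖B‖ * ‖f (σ n)‖ * ‖g‖ := B.le_opNorm₂ _ _
      _ ≤ ‖B‖ * ‖f (σ n)‖ := mul_le_of_le_one_right (by positivity) hg.2
      _ ≤ ‖B‖ * C := by gcongr; exact hC _
  have hptw : ∀ y, Tendsto (fun n => h n y) atTop (𝓝 0) := by
    rintro ⟨_, g, hg, rfl⟩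
    have := ((hlim g hg.1).comp hσ.tendsto_atTop).rpow_const (p := q) (Or.inr hq0.le)
    rwa [Real.zero_rpow hq0.ne'] at this
  set ε := δ / (K + 1) with hε_def
  have hε : 0 < ε := by positivity
  obtain ⟨u, hu, hlt⟩ := exists_mem_convexHull_range_forall_lt h hbound hptw
    (Real.rpow_pos_of_pos hε q)
  rw [convexHull_eq] at hu
  obtain ⟨ι, t, w, z, hw, hw1, hz, rfl⟩ := hu
  rw [Finset.centerMass_eq_of_sum_1 _ _ hw1] at hlt
  choose! m hm using hz
  have hle := hT.le_of_forall_weighted_sum_le hq hK t w hw (fun i => f (σ (m i))) hε.le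
    fun g hg => by
      have hg' := (hlt ⟨Φ g, g, hg, rfl⟩).le
      rw [Finset.sum_congr rfl fun i hi => by rw [← hm i hi]] at hg'
      simpa [h, Φ, ContinuousMap.sum_apply] using hg'
  have hge : δ ^ q ≤ ∑ i ∈ t, w i * ‖T (f (σ (m i)))‖ ^ q :=
    calc δ ^ q = ∑ i ∈ t, w i * δ ^ q := by rw [← Finset.sum_mul, hw1, one_mul]
      _ ≤ _ := Finset.sum_le_sum fun i hi => mul_le_mul_of_nonneg_left
        (Real.rpow_le_rpow hδ.le (hδσ _) hq0.le) (hw i hi)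
  have hδle : δ ≤ K * ε :=
    calc δ = (δ ^ q) ^ (1 / q) := by
          rw [← Real.rpow_mul hδ.le, mul_one_div_cancel hq0.ne', Real.rpow_one]
      _ ≤ _ := Real.rpow_le_rpow (by positivity) hge (by positivity)
      _ ≤ K * ε := hle
  have hδ_eq : (K + 1) * ε = δ := by rw [hε_def]; field_simp
  linarith
end
end

section
/- Let 1 ≤ q < ∞, assume X is reflexive, and let P ⊆ S ⊆ F and R ⊆ G be subspaces such that the closed unit ball of R is compact in the topology τ_B(S). Then every (q,R)-summing operator T : P → E is weakly compact: the image under T of the closed unit ball of P is relatively weakly compact in E. -/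
open scoped BigOperators

noncomputable section

variable {F G X E : Type*}
variable [NormedAddCommGroup F] [NormedSpace ℝ F] [CompleteSpace F]
variable [NormedAddCommGroup G] [NormedSpace ℝ G] [CompleteSpace G]
variable [NormedAddCommGroup X] [NormedSpace ℝ X] [CompleteSpace X]
variable [NormedAddCommGroup E] [NormedSpace ℝ E] [CompleteSpace E]

open Filter Topology MeasureTheory

section Banach

variable {V : Type*} [NormedAddCommGroup V] [NormedSpace ℝ V]

/-- In a reflexive space every bounded family converges weakly along every ultrafilter. -/
theorem exists_weak_limit_of_ultrafilter
    (hV : Function.Surjective (NormedSpace.inclusionInDoubleDual ℝ V))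
    {ι : Type*} (U : Ultrafilter ι) (x : ι → V) {M : ℝ} (hx : ∀ i, ‖x i‖ ≤ M) :
    ∃ y : V, ∀ φ : StrongDual ℝ V, Tendsto (fun i => φ (x i)) U (𝓝 (φ y)) := by
  have hbd : ∀ (φ : StrongDual ℝ V) i, ‖φ (x i)‖ ≤ M * ‖φ‖ := fun φ i => by
    rw [mul_comm]; exact φ.le_opNorm_of_le (hx i)
  have hlim : ∀ φ : StrongDual ℝ V, ∃ r ∈ Metric.closedBall (0 : ℝ) (M * ‖φ‖),
      Tendsto (fun i => φ (x i)) U (𝓝 r) := fun φ =>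
    (isCompact_closedBall (0 : ℝ) (M * ‖φ‖)).ultrafilter_le_nhds (U.map fun i => φ (x i))
      (by
        rw [le_principal_iff]
        exact Filter.mem_map.2 (Filter.univ_mem' fun i => by simpa using hbd φ i))
  choose ξ hξM hξ using hlim
  let Ξ : StrongDual ℝ V →ₗ[ℝ] ℝ :=
    { toFun := ξ
      map_add' := fun φ ψ => tendsto_nhds_unique (hξ (φ + ψ)) ((hξ φ).add (hξ ψ))
      map_smul' := fun c φ => tendsto_nhds_unique (hξ (c • φ)) ((hξ φ).const_mul c) }
  obtain ⟨y, hy⟩ := hV (Ξ.mkContinuous M fun φ => by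
    have h := hξM φ
    rwa [mem_closedBall_zero_iff] at h)
  refine ⟨y, fun φ => ?_⟩
  have h : φ y = ξ φ := congrArg (fun Λ => Λ φ) hy
  rw [h]
  exact hξ φ

/-- A closed convex set contains the limits, along a filter, of weakly convergent nets in it. -/
theorem mem_closure_convexHull_of_tendsto {ι : Type*} {l : Filter ι} [l.NeBot] {x : ι → V} {y : V}
    (hxy : ∀ φ : StrongDual ℝ V, Tendsto (fun i => φ (x i)) l (𝓝 (φ y)))
    {s : Set V} (hs : ∀ᶠ i in l, x i ∈ s) : y ∈ closure (convexHull ℝ s) := by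
  by_contra hy
  obtain ⟨φ, u, hlt, hu⟩ := geometric_hahn_banach_closed_point
    (convex_convexHull ℝ s).closure isClosed_closure hy
  exact (le_of_tendsto (hxy φ) (hs.mono fun i hi =>
    (hlt _ (subset_closure (subset_convexHull ℝ s hi))).le)).not_gt hu

/-- Closed subspaces of reflexive spaces are reflexive. -/
theorem surjective_inclusionInDoubleDual_of_isClosed
    (hV : Function.Surjective (NormedSpace.inclusionInDoubleDual ℝ V))
    (Y : Submodule ℝ V) (hY : IsClosed (Y : Set V)) :
    Function.Surjective (NormedSpace.inclusionInDoubleDual ℝ Y) := by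
  intro ξ
  obtain ⟨x, hx⟩ := hV (ξ.comp ((ContinuousLinearMap.compL ℝ Y V ℝ).flip Y.subtypeL))
  have hx' : ∀ φ : StrongDual ℝ V, φ x = ξ (φ.comp Y.subtypeL) :=
    fun φ => congrArg (fun Λ => Λ φ) hx
  have hxY : x ∈ Y := by
    by_contra h
    obtain ⟨φ, u, hlt, hu⟩ := geometric_hahn_banach_closed_point Y.convex hY h
    have h0 : ∀ y ∈ Y, φ y = 0 := by
      intro y hy
      by_contra hne
      have := hlt ((u / φ y) • y) (Y.smul_mem _ hy)
      rw [map_smul, smul_eq_mul, div_mul_cancel₀ _ hne] at this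
      exact lt_irrefl _ this
    have h1 : φ.comp Y.subtypeL = 0 := by
      ext y
      exact h0 y y.2
    have h2 := hx' φ
    rw [h1, map_zero] at h2
    have h3 := hlt 0 Y.zero_mem
    rw [map_zero] at h3
    linarith
  refine ⟨⟨x, hxY⟩, ?_⟩
  ext ψ
  obtain ⟨φ, hφ, -⟩ := exists_extension_norm_eq Y ψ
  have h1 : φ.comp Y.subtypeL = ψ := by
    ext y
    exact hφ y
  rw [NormedSpace.dual_def, ← h1, ← hx' φ]
  rfl

/-- Hilbert spaces are reflexive. -/
theorem surjective_inclusionInDoubleDual_of_inner {H : Type*} [NormedAddCommGroup H]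
    [InnerProductSpace ℝ H] [CompleteSpace H] :
    Function.Surjective (NormedSpace.inclusionInDoubleDual ℝ H) := by
  intro ξ
  let D := InnerProductSpace.toDual ℝ H
  let Λ : H →ₗ[ℝ] ℝ :=
    { toFun := fun z => ξ (D z)
      map_add' := fun y z => by simp
      map_smul' := fun c z => by simp [D] }
  refine ⟨D.symm (Λ.mkContinuous ‖ξ‖ fun z => ?_), ?_⟩
  · exact (ξ.le_opNorm (D z)).trans_eq (by rw [LinearIsometryEquiv.norm_map])
  ext φ
  obtain ⟨z, rfl⟩ := D.surjective φ
  rw [NormedSpace.dual_def, InnerProductSpace.toDual_apply_apply, real_inner_comm,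
    ← InnerProductSpace.toDual_apply_apply (𝕜 := ℝ), LinearIsometryEquiv.apply_symm_apply]
  rfl

/-- In a Hilbert space, every bounded sequence has convex blocks converging in norm. -/
theorem exists_forall_mem_closure_convexHull_tail {H : Type*} [NormedAddCommGroup H]
    [InnerProductSpace ℝ H] [CompleteSpace H] (u : ℕ → H) {M : ℝ} (hu : ∀ n, ‖u n‖ ≤ M) :
    ∃ v : H, ∀ n, v ∈ closure (convexHull ℝ (u '' Set.Ici n)) := by
  obtain ⟨v, hv⟩ := exists_weak_limit_of_ultrafilter surjective_inclusionInDoubleDual_of_inner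
    (hyperfilter ℕ) u hu
  refine ⟨v, fun n => mem_closure_convexHull_of_tendsto hv ?_⟩
  have : ∀ᶠ i in atTop, u i ∈ u '' Set.Ici n :=
    (eventually_ge_atTop n).mono fun i hi => ⟨i, hi, rfl⟩
  exact Nat.hyperfilter_le_atTop this

/-- A separable normed space admits a continuous linear injection into a Hilbert space. -/
theorem exists_injective_clm_lp [TopologicalSpace.SeparableSpace V] :
    ∃ J : V →L[ℝ] lp (fun _ : ℕ => ℝ) 2, Function.Injective J := by
  have hd := TopologicalSpace.denseRange_denseSeq V
  set d := TopologicalSpace.denseSeq V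
  choose φ hφ1 hφ using fun j => exists_dual_vector'' ℝ (d j)
  have hsq : ∀ x j, ‖(1 / 2 : ℝ) ^ j * φ j x‖ ^ 2 ≤ ‖x‖ ^ 2 * (1 / 4 : ℝ) ^ j := fun x j => by
    have h1 : ‖φ j x‖ ≤ ‖x‖ := by simpa using (φ j).le_of_opNorm_le (hφ1 j) x
    have h2 : ‖φ j x‖ ^ 2 ≤ ‖x‖ ^ 2 := by gcongr
    rw [norm_mul, norm_pow, mul_pow, show ‖(1 / 2 : ℝ)‖ = 1 / 2 by norm_num, ← pow_mul,
      mul_comm j 2, pow_mul, show ((1 / 2 : ℝ) ^ 2) = 1 / 4 by norm_num, mul_comm]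
    gcongr
  have hgeo : HasSum (fun j : ℕ => (1 / 4 : ℝ) ^ j) (1 - 1 / 4)⁻¹ :=
    hasSum_geometric_of_lt_one (by norm_num) (by norm_num)
  have hmem : ∀ x, Memℓp (fun j => (1 / 2 : ℝ) ^ j * φ j x) 2 := fun x =>
    memℓp_gen ((hgeo.summable.mul_left (‖x‖ ^ 2)).of_nonneg_of_le (fun j => by positivity)
      fun j => by simpa only [ENNReal.toReal_ofNat, Real.rpow_ofNat] using hsq x j)
  let J₀ : V →ₗ[ℝ] lp (fun _ : ℕ => ℝ) 2 :=
    { toFun := fun x => ⟨_, hmem x⟩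
      map_add' := fun x y => Subtype.ext <| funext fun j => by
        change (1 / 2 : ℝ) ^ j * φ j (x + y) = (1 / 2 : ℝ) ^ j * φ j x + (1 / 2 : ℝ) ^ j * φ j y
        rw [map_add, mul_add]
      map_smul' := fun c x => Subtype.ext <| funext fun j => by
        change (1 / 2 : ℝ) ^ j * φ j (c • x) = c * ((1 / 2 : ℝ) ^ j * φ j x)
        rw [map_smul, smul_eq_mul, mul_left_comm] }
  have hJ₀ : ∀ x, ‖J₀ x‖ ≤ 2 * ‖x‖ := fun x => by
    refine lp.norm_le_of_forall_sum_le (by norm_num) (by positivity) fun s => ?_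
    simp only [ENNReal.toReal_ofNat, Real.rpow_ofNat]
    calc ∑ j ∈ s, ‖J₀ x j‖ ^ 2 ≤ ∑ j ∈ s, ‖x‖ ^ 2 * (1 / 4 : ℝ) ^ j :=
          Finset.sum_le_sum fun j _ => hsq x j
      _ ≤ ‖x‖ ^ 2 * (1 - 1 / 4)⁻¹ :=
          sum_le_hasSum s (fun j _ => by positivity) (hgeo.mul_left _)
      _ ≤ (2 * ‖x‖) ^ 2 := by nlinarith [sq_nonneg ‖x‖]
  refine ⟨J₀.mkContinuous 2 hJ₀, ?_⟩
  rw [injective_iff_map_eq_zero]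
  intro x hx
  have hx0 : ∀ j, φ j x = 0 := fun j => by
    have h := congrArg (fun z : lp (fun _ : ℕ => ℝ) 2 => z j) hx
    have h' : (1 / 2 : ℝ) ^ j * φ j x = 0 := h
    simpa using h'
  have hle : ∀ y : V, ‖y‖ ≤ ‖y - x‖ := fun y => by
    refine hd.induction_on (p := fun y => ‖y‖ ≤ ‖y - x‖) y
      (isClosed_le (by fun_prop) (by fun_prop)) fun j => ?_
    have h : φ j (d j - x) = ‖d j‖ := by rw [map_sub, hφ, hx0, sub_zero]; rfl
    calc ‖d j‖ = φ j (d j - x) := h.symm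
      _ ≤ ‖φ j (d j - x)‖ := le_abs_self _
      _ ≤ _ := by simpa using (φ j).le_of_opNorm_le (hφ1 j) (d j - x)
  simpa using hle x

end Banach

section Whitley

variable {V : Type*} [NormedAddCommGroup V] [NormedSpace ℝ V]

/-- Finitely many unit vectors norm a finite-dimensional space of functionals up to a factor `2`. -/
theorem exists_finset_norming (W : Submodule ℝ (StrongDual ℝ V)) [FiniteDimensional ℝ W] :
    ∃ Φ : Finset V, (∀ x ∈ Φ, ‖x‖ ≤ 1) ∧
      ∀ v ∈ W, ∀ c : ℝ, (∀ x ∈ Φ, |v x| ≤ c) → 0 ≤ c → ‖v‖ ≤ 2 * c := by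
  classical
  have : ProperSpace W := FiniteDimensional.proper_real W
  have hx : ∀ v : W, ∃ x : V, ‖x‖ ≤ 1 ∧ (‖v‖ = 1 → 1 / 2 < ‖(v : StrongDual ℝ V) x‖) := fun v => by
    by_cases hv : ‖v‖ = 1
    · obtain ⟨x, hx1, hx⟩ := ContinuousLinearMap.exists_lt_apply_of_lt_opNorm
        (v : StrongDual ℝ V) (r := 1 / 2) (by
          change 1 / 2 < ‖v‖
          rw [hv]; norm_num)
      exact ⟨x, hx1.le, fun _ => hx⟩
    · exact ⟨0, by simp, fun h => absurd h hv⟩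
  choose x hx1 hx using hx
  obtain ⟨t, ht1, ht⟩ := (isCompact_sphere (0 : W) 1).elim_nhds_subcover
    (fun v => {w : W | 1 / 2 < ‖(w : StrongDual ℝ V) (x v)‖}) fun v hv => by
      refine (isOpen_lt continuous_const ?_).mem_nhds (hx v ((dist_zero_right v).symm.trans hv))
      have : Continuous fun w : W => (w : StrongDual ℝ V) (x v) :=
        ((ContinuousLinearMap.apply ℝ ℝ (x v)).continuous).comp continuous_subtype_val
      exact this.norm
  refine ⟨t.image x, fun y hy => ?_, fun v hv c hc hc0 => ?_⟩
  · obtain ⟨w, -, rfl⟩ := Finset.mem_image.1 hy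
    exact hx1 w
  · rcases eq_or_ne v 0 with rfl | hv0
    · simpa using hc0
    have hn : 0 < ‖v‖ := norm_pos_iff.2 hv0
    let w : W := ‖v‖⁻¹ • ⟨v, hv⟩
    have hw : ‖w‖ = 1 := by
      change ‖‖v‖⁻¹ • v‖ = 1
      rw [norm_smul, norm_inv, norm_norm, inv_mul_cancel₀ hn.ne']
    obtain ⟨u, hu, hwu⟩ := Set.mem_iUnion₂.1
      (ht ((dist_zero_right w).trans hw : w ∈ Metric.sphere (0 : W) 1))
    have h1 : 1 / 2 < ‖‖v‖⁻¹ • v (x u)‖ := hwu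
    have h2 := hc (x u) (Finset.mem_image_of_mem x hu)
    rw [norm_smul, norm_inv, norm_norm, Real.norm_eq_abs, inv_mul_eq_div, lt_div_iff₀ hn] at h1
    linarith

/-- A bounded set is relatively weakly compact if every sequence in it admits a point lying in the
closed convex hull of each of its tails. -/
theorem isCompact_closure_toWeakSpace_of_forall_seq {A : Set V} (hA : Bornology.IsBounded A)
    (hseq : ∀ a : ℕ → V, (∀ n, a n ∈ A) →
      ∃ x : V, ∀ n, x ∈ closure (convexHull ℝ (a '' Set.Ici n))) :
    IsCompact (closure (toWeakSpace ℝ V '' A)) := by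
  classical
  refine NormedSpace.isCompact_closure_of_isBounded ℝ V _ ?_ fun ξw hξw => ?_
  · rwa [Set.preimage_image_eq _ (toWeakSpace ℝ V).injective]
  let ξ : StrongDual ℝ (StrongDual ℝ V) := WeakDual.toStrongDual ξw
  let ι := NormedSpace.inclusionInDoubleDual ℝ V
  have happrox : ∀ (Φ : Finset (StrongDual ℝ V)) (n : ℕ),
      ∃ a ∈ A, ∀ φ ∈ Φ, |φ a - ξ φ| ≤ 1 / (n + 1 : ℝ) := fun Φ n => by
    have hU :
        {η : WeakDual ℝ (StrongDual ℝ V) | ∀ φ ∈ Φ, |η φ - ξ φ| < 1 / (n + 1 : ℝ)} ∈ 𝓝 ξw := by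
      have : {η : WeakDual ℝ (StrongDual ℝ V) | ∀ φ ∈ Φ, |η φ - ξ φ| < 1 / (n + 1 : ℝ)} =
          ⋂ φ ∈ Φ, {η | |η φ - ξ φ| < 1 / (n + 1 : ℝ)} := by
        ext; simp
      rw [this]
      refine (biInter_finset_mem Φ).2 fun φ _ => ?_
      refine (isOpen_lt ?_ continuous_const).mem_nhds ?_
      · exact ((WeakDual.eval_continuous φ).sub continuous_const).abs
      · change |ξ φ - ξ φ| < _
        rw [sub_self, abs_zero]
        positivity
    obtain ⟨_, hη, _, ⟨a, ha, rfl⟩, rfl⟩ := mem_closure_iff_nhds.1 hξw _ hU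
    exact ⟨a, ha, fun φ hφ => (hη φ hφ).le⟩
  choose pick hpickA hpick using happrox
  let W : Finset V → Submodule ℝ (StrongDual ℝ (StrongDual ℝ V)) := fun L =>
    Submodule.span ℝ (insert ξ (L.image ι) : Finset (StrongDual ℝ (StrongDual ℝ V)))
  choose N hN1 hN using fun L => exists_finset_norming (W L)
  let L : ℕ → Finset V := fun n =>
    Nat.rec ∅ (fun n L => insert (pick (L.powerset.biUnion N) n) L) n
  let a : ℕ → V := fun n => pick ((L n).powerset.biUnion N) n
  have hLsucc : ∀ n, L (n + 1) = insert (a n) (L n) := fun n => rfl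
  have hLmono : Monotone L := monotone_nat_of_le_succ fun n => by
    rw [hLsucc]; exact Finset.subset_insert _ _
  have haL : ∀ {k n}, k < n → a k ∈ L n := fun {k n} h =>
    hLmono (Nat.succ_le_of_lt h) (by rw [hLsucc]; exact Finset.mem_insert_self _ _)
  have ha : ∀ {m n}, m ≤ n → ∀ φ ∈ N (L m), |φ (a n) - ξ φ| ≤ 1 / (n + 1 : ℝ) :=
    fun {m n} hmn φ hφ => hpick _ n φ
      (Finset.mem_biUnion.2 ⟨L m, Finset.mem_powerset.2 (hLmono hmn), hφ⟩)
  obtain ⟨x, hx⟩ := hseq a fun n => hpickA _ _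
  have hxφ : ∀ m, ∀ φ ∈ N (L m), φ x = ξ φ := fun m φ hφ => by
    have hle : ∀ n ≥ m, |φ x - ξ φ| ≤ 1 / (n + 1 : ℝ) := fun n hn => by
      have hconv : Convex ℝ {y : V | |φ y - ξ φ| ≤ 1 / (n + 1 : ℝ)} := by
        have : {y : V | |φ y - ξ φ| ≤ 1 / (n + 1 : ℝ)} =
            φ ⁻¹' Metric.closedBall (ξ φ) (1 / (n + 1 : ℝ)) := by
          ext y; simp [Real.dist_eq]
        rw [this]
        exact (convex_closedBall _ _).linear_preimage φ.toLinearMap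
      refine closure_minimal (convexHull_min ?_ hconv)
        (isClosed_le (by fun_prop) continuous_const) (hx n)
      rintro _ ⟨k, hk, rfl⟩
      refine (ha (hn.trans hk) φ hφ).trans ?_
      have : (n : ℝ) ≤ k := by exact_mod_cast hk
      gcongr
    have h0 := ge_of_tendsto tendsto_one_div_add_atTop_nhds_zero_nat
      ((eventually_ge_atTop m).mono hle)
    exact sub_eq_zero.1 (abs_eq_zero.1 (le_antisymm h0 (abs_nonneg _)))
  have hxspan : x ∈ closure (⋃ n : ℕ, (Submodule.span ℝ (SetLike.coe (L n)) : Set V)) := by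
    refine closure_mono ?_ (hx 0)
    intro y hy
    have hdir : Directed (· ≤ ·) fun n : ℕ => Submodule.span ℝ (SetLike.coe (L n)) :=
      Monotone.directed_le fun m n h => Submodule.span_mono (Finset.coe_subset.2 (hLmono h))
    rw [← Submodule.coe_iSup_of_directed _ hdir]
    refine convexHull_min ?_ (Submodule.convex _) hy
    rintro _ ⟨k, -, rfl⟩
    exact Submodule.mem_iSup_of_mem (k + 1)
      (Submodule.subset_span (Finset.mem_coe.2 (haL k.lt_succ_self)))
  have hξ : ξ = ι x := by
    refine eq_of_norm_sub_le_zero (le_of_forall_pos_le_add fun ε hε => ?_)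
    obtain ⟨y, hy, hxy⟩ := Metric.mem_closure_iff.1 hxspan (ε / 3) (by positivity)
    obtain ⟨n, hyn⟩ := Set.mem_iUnion.1 hy
    rw [dist_eq_norm] at hxy
    have hιy : ι y ∈ W (L n) := by
      have := Submodule.mem_map_of_mem (f := ι.toLinearMap) hyn
      rw [Submodule.map_span] at this
      refine Submodule.span_mono ?_ this
      rintro _ ⟨z, hz, rfl⟩
      exact Finset.mem_coe.2 (Finset.mem_insert_of_mem (Finset.mem_image_of_mem ι hz))
    have hmem : ξ - ι y ∈ W (L n) := Submodule.sub_mem _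
      (Submodule.subset_span (Finset.mem_coe.2 (Finset.mem_insert_self _ _))) hιy
    have h1 := hN (L n) _ hmem (ε / 3) (fun φ hφ => by
      have h2 : (ξ - ι y) φ = φ (x - y) := by
        change ξ φ - φ y = _
        rw [map_sub, hxφ n φ hφ]
      rw [h2]
      have := φ.le_of_opNorm_le (hN1 _ φ hφ) (x - y)
      rw [Real.norm_eq_abs] at this
      linarith) (by positivity)
    have h2 : ‖ι (y - x)‖ ≤ ‖x - y‖ := by
      rw [norm_sub_rev x y]; exact NormedSpace.double_dual_bound ℝ V _
    calc ‖ξ - ι x‖ = ‖(ξ - ι y) + ι (y - x)‖ := by rw [map_sub]; congr 1; abel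
      _ ≤ ‖ξ - ι y‖ + ‖ι (y - x)‖ := norm_add_le (ξ - ι y) (ι (y - x))
      _ ≤ 0 + ε := by linarith
  refine ⟨toWeakSpace ℝ V x, ?_⟩
  exact DFunLike.ext _ _ fun φ => (congrArg (fun Λ => Λ φ) hξ).symm

end Whitley

section Domination

/-- A continuous function on a compact space is integrable for finite measures. -/
theorem integrable_of_continuous_of_compactSpace {W V : Type*} [TopologicalSpace W]
    [CompactSpace W] [MeasurableSpace W] [BorelSpace W] [NormedAddCommGroup V]
    (μ : Measure W) [IsFiniteMeasure μ] {f : W → V} (hf : Continuous f) : Integrable f μ :=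
  hf.integrable_of_hasCompactSupport (HasCompactSupport.of_compactSpace f)

/-- If every member of a convex set of continuous functions on a compact space reaches the level
`δ > 0`, then some regular measure of mass at most one integrates all of them to at least `δ`. -/
theorem exists_measure_forall_le_integral {W : Type*} [TopologicalSpace W] [CompactSpace W]
    [T2Space W] [MeasurableSpace W] [BorelSpace W] {C : Set C(W, ℝ)} (hC : Convex ℝ C) {δ : ℝ}
    (hδ : 0 < δ) (h : ∀ d ∈ C, ∃ w, δ ≤ d w) :
    ∃ μ : Measure W, IsFiniteMeasure μ ∧ μ.Regular ∧ μ.real Set.univ ≤ 1 ∧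
      ∀ d ∈ C, δ ≤ ∫ w, d w ∂μ := by
  let U : Set C(W, ℝ) := {f | ∀ w, f w < δ}
  have hUconv : Convex ℝ U := fun f hf g hg a b ha hb hab w =>
    (convex_Iio δ) (hf w) (hg w) ha hb hab
  have hUopen : IsOpen U := by
    have := ContinuousMap.isOpen_setOfPred_mapsTo (X := W) (Y := ℝ) isCompact_univ
      (isOpen_Iio (a := δ))
    simpa [Set.MapsTo, U] using this
  obtain ⟨F, s, hFU, hFC⟩ := geometric_hahn_banach_open hUconv hUopen hC
    (Set.disjoint_left.2 fun f hf hfC => by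
      obtain ⟨w, hw⟩ := h f hfC
      exact (hf w).not_ge hw)
  have hs : 0 < s := by simpa using hFU 0 fun w => hδ
  have hpos : ∀ f : C(W, ℝ), (∀ w, 0 ≤ f w) → 0 ≤ F f := fun f hf => by
    by_contra! hneg
    have h1 : (s / F f) • f ∈ U := fun w => by
      refine lt_of_le_of_lt ?_ hδ
      exact mul_nonpos_of_nonpos_of_nonneg (div_nonpos_of_nonneg_of_nonpos hs.le hneg.le) (hf w)
    have h2 := hFU _ h1
    rw [map_smul, smul_eq_mul, div_mul_cancel₀ _ hneg.ne] at h2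
    exact lt_irrefl _ h2
  have hone : δ * F 1 ≤ s := by
    have hlt : ∀ r < δ, r * F 1 ≤ s := fun r hr => by
      have h2 := (hFU (r • (1 : C(W, ℝ))) fun w => by simpa using hr).le
      rwa [map_smul, smul_eq_mul] at h2
    have hc : Tendsto (fun r : ℝ => r * F 1) (𝓝[<] δ) (𝓝 (δ * F 1)) :=
      (tendsto_id.mono_left nhdsWithin_le_nhds).mul_const _
    exact le_of_tendsto hc (eventually_nhdsWithin_of_forall hlt)
  let Λ : CompactlySupportedContinuousMap W ℝ →ₚ[ℝ] ℝ := PositiveLinearMap.mk₀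
    { toFun := fun f => δ / s * F f.toContinuousMap
      map_add' := fun f g => by
        rw [← mul_add, ← map_add]; rfl
      map_smul' := fun c f => by
        change δ / s * F (c • f.toContinuousMap) = c * (δ / s * F f.toContinuousMap)
        rw [map_smul, smul_eq_mul, mul_left_comm] }
    fun f hf => mul_nonneg (by positivity) (hpos _ fun w => hf w)
  have hint : ∀ f : C(W, ℝ), ∫ w, f w ∂(RealRMK.rieszMeasure Λ) = δ / s * F f := fun f =>
    RealRMK.integral_rieszMeasure Λ ⟨f, HasCompactSupport.of_compactSpace f⟩
  have hreg : (RealRMK.rieszMeasure Λ).Regular := inferInstance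
  have hfin : IsFiniteMeasure (RealRMK.rieszMeasure Λ) := inferInstance
  refine ⟨RealRMK.rieszMeasure Λ, hfin, hreg, ?_, fun d hd => ?_⟩
  · have h1 := hint 1
    simp only [ContinuousMap.one_apply, integral_const, smul_eq_mul, mul_one] at h1
    rw [h1, div_mul_eq_mul_div, div_le_one hs]
    exact hone
  · rw [hint, div_mul_eq_mul_div, le_div_iff₀ hs]
    exact mul_le_mul_of_nonneg_left (hFC d hd) hδ.le

/-- Positive homogeneity of `‖·‖ ^ q`. -/
theorem norm_rpow_one_div_smul_rpow {V : Type*} [NormedAddCommGroup V] [NormedSpace ℝ V]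
    {q t : ℝ} (hq : 0 < q) (ht : 0 ≤ t) (v : V) : ‖t ^ (1 / q) • v‖ ^ q = t * ‖v‖ ^ q := by
  have ht' : 0 ≤ t ^ (1 / q) := by positivity
  rw [norm_smul, Real.norm_of_nonneg ht', Real.mul_rpow ht' (norm_nonneg _), ← Real.rpow_mul ht,
    one_div_mul_cancel hq.ne', Real.rpow_one]

/-- Pietsch domination for an operator `T` dominated on finite families by the functions `b f`. -/
theorem exists_measure_pietsch_domination {Ω P E X : Type*} [TopologicalSpace Ω] [CompactSpace Ω]
    [T2Space Ω] [MeasurableSpace Ω] [BorelSpace Ω] [NormedAddCommGroup P] [NormedSpace ℝ P]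
    [NormedAddCommGroup E] [NormedSpace ℝ E] [NormedAddCommGroup X] [NormedSpace ℝ X]
    (T : P →ₗ[ℝ] E) (b : P →ₗ[ℝ] C(Ω, X)) {q c : ℝ} (hq : 1 ≤ q)
    (h : ∀ (n : ℕ) (f : Fin n → P), ∃ ω, ∑ i, ‖T (f i)‖ ^ q ≤ c * ∑ i, ‖b (f i) ω‖ ^ q) :
    ∃ μ : Measure Ω, IsFiniteMeasure μ ∧ μ.Regular ∧ μ.real Set.univ ≤ 1 ∧
      ∀ f, ‖T f‖ ^ q ≤ c * ∫ ω, ‖b f ω‖ ^ q ∂μ := by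
  have hq0 : 0 < q := by linarith
  have hcont : ∀ f, Continuous fun ω => ‖b f ω‖ ^ q := fun f =>
    (b f).continuous.norm.rpow_const fun _ => Or.inr hq0.le
  let D : P → C(Ω, ℝ) := fun f =>
    ⟨fun ω => 1 + (c * ‖b f ω‖ ^ q - ‖T f‖ ^ q), by have := hcont f; fun_prop⟩
  obtain ⟨μ, hfin, hreg, hmass, hμ⟩ := exists_measure_forall_le_integral
    (convex_convexHull ℝ (Set.range D)) one_pos fun d hd => by
      obtain ⟨ι, _, w, z, hw0, hw1, hz, rfl⟩ := mem_convexHull_iff_exists_fintype.1 hd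
      choose g hg using hz
      let e := Fintype.equivFin ι
      obtain ⟨ω, hω⟩ := h (Fintype.card ι) fun i => (w (e.symm i)) ^ (1 / q) • g (e.symm i)
      refine ⟨ω, ?_⟩
      simp only [map_smul, ContinuousMap.smul_apply,
        norm_rpow_one_div_smul_rpow hq0 (hw0 _)] at hω
      rw [e.symm.sum_comp fun i => w i * ‖T (g i)‖ ^ q,
        e.symm.sum_comp fun i => w i * ‖b (g i) ω‖ ^ q] at hω
      have : (∑ i, w i • z i) ω = ∑ i, w i * (1 + (c * ‖b (g i) ω‖ ^ q - ‖T (g i)‖ ^ q)) := by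
        rw [ContinuousMap.sum_apply]
        exact Finset.sum_congr rfl fun i _ => by rw [← hg i]; rfl
      rw [this]
      simp only [mul_add, mul_sub, Finset.sum_add_distrib, Finset.sum_sub_distrib, mul_one, hw1,
        mul_left_comm _ c, ← Finset.mul_sum]
      linarith
  refine ⟨μ, hfin, hreg, hmass, fun f => ?_⟩
  have h1 := hμ (D f) (subset_convexHull ℝ _ ⟨f, rfl⟩)
  have hi : Integrable (fun ω => ‖b f ω‖ ^ q) μ :=
    integrable_of_continuous_of_compactSpace μ (hcont f)
  have h2 : ∫ ω, D f ω ∂μ =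
      μ.real Set.univ + (c * ∫ ω, ‖b f ω‖ ^ q ∂μ - μ.real Set.univ * ‖T f‖ ^ q) := by
    have hsub : Integrable (fun ω => c * ‖b f ω‖ ^ q - ‖T f‖ ^ q) μ :=
      (hi.const_mul c).sub (integrable_const _)
    change ∫ ω, (1 + (c * ‖b f ω‖ ^ q - ‖T f‖ ^ q)) ∂μ = _
    rw [integral_add (integrable_const _) hsub,
      integral_sub (hi.const_mul c) (integrable_const _), integral_const_mul]
    simp
  have h3 : 1 ≤ μ.real Set.univ := by
    have h4 := hμ (D 0) (subset_convexHull ℝ _ ⟨0, rfl⟩)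
    have h5 : D 0 = 1 := by
      ext ω
      change 1 + (c * ‖b 0 ω‖ ^ q - ‖T 0‖ ^ q) = 1
      simp [Real.zero_rpow hq0.ne']
    simpa [h5] using h4
  rw [h2, le_antisymm hmass h3] at h1
  linarith

end Domination

section Blocks

variable {Y : Type*} [NormedAddCommGroup Y] [NormedSpace ℝ Y]

/-- The pairing of `C(Ω, Y)` with the product of `Ω` and the weak-star compact dual ball. -/
def dualBallPairing (Ω Y : Type*) [TopologicalSpace Ω] [NormedAddCommGroup Y] [NormedSpace ℝ Y] :
    C(Ω, Y) →ₗ[ℝ]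
      C(Ω × (WeakDual.toStrongDual ⁻¹' Metric.closedBall (0 : StrongDual ℝ Y) 1 :
        Set (WeakDual ℝ Y)), ℝ) where
  toFun w := ⟨fun p => (p.2 : WeakDual ℝ Y) (w p.1), by
    rw [continuous_iff_continuousAt]
    rintro ⟨ω₀, φ₀⟩
    have h1 : Tendsto (fun p : Ω × (WeakDual.toStrongDual ⁻¹'
        Metric.closedBall (0 : StrongDual ℝ Y) 1 : Set (WeakDual ℝ Y)) =>
        (p.2 : WeakDual ℝ Y) (w p.1 - w ω₀)) (𝓝 (ω₀, φ₀)) (𝓝 0) := by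
      refine squeeze_zero_norm (a := fun p => ‖w p.1 - w ω₀‖) (fun p => ?_) ?_
      · have h := (WeakDual.toStrongDual (p.2 : WeakDual ℝ Y)).le_of_opNorm_le
          (mem_closedBall_zero_iff.1 p.2.2) (w p.1 - w ω₀)
        rwa [one_mul] at h
      · have hc : Continuous fun p : Ω × (WeakDual.toStrongDual ⁻¹'
            Metric.closedBall (0 : StrongDual ℝ Y) 1 : Set (WeakDual ℝ Y)) =>
            ‖w p.1 - w ω₀‖ := by fun_prop
        simpa using hc.tendsto (ω₀, φ₀)
    have h2 : Continuous fun p : Ω × (WeakDual.toStrongDual ⁻¹'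
        Metric.closedBall (0 : StrongDual ℝ Y) 1 : Set (WeakDual ℝ Y)) =>
        (p.2 : WeakDual ℝ Y) (w ω₀) :=
      (WeakDual.eval_continuous (w ω₀)).comp (continuous_subtype_val.comp continuous_snd)
    have h3 := h1.add (h2.tendsto (ω₀, φ₀))
    rw [zero_add] at h3
    refine h3.congr fun p => ?_
    rw [map_sub, sub_add_cancel]⟩
  map_add' v w := by
    ext p
    exact map_add (p.2 : WeakDual ℝ Y) _ _
  map_smul' c w := by
    ext p
    exact map_smul (p.2 : WeakDual ℝ Y) _ _

/-- A bounded sequence of continuous functions whose pointwise weak limits have norm at most `δ`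
has convex blocks that are uniformly of norm at most `2 * δ`. -/
theorem exists_mem_convexHull_tail_forall_norm_le {Ω : Type*} [TopologicalSpace Ω] [CompactSpace Ω]
    [T2Space Ω] {w : ℕ → C(Ω, Y)} {M δ : ℝ} (hδ : 0 < δ) (hw : ∀ n ω, ‖w n ω‖ ≤ M) {z : Ω → Y}
    (hz : ∀ ω, ‖z ω‖ ≤ δ)
    (hwz : ∀ ω, ∀ φ : StrongDual ℝ Y, Tendsto (fun n => φ (w n ω)) atTop (𝓝 (φ (z ω)))) (N : ℕ) :
    ∃ v ∈ convexHull ℝ (w '' Set.Ici N), ∀ ω, ‖v ω‖ ≤ 2 * δ := by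
  by_contra! hcon
  let B : Set (WeakDual ℝ Y) := WeakDual.toStrongDual ⁻¹' Metric.closedBall (0 : StrongDual ℝ Y) 1
  have : CompactSpace B := isCompact_iff_compactSpace.1 (WeakDual.isCompact_closedBall _ _)
  let _ : MeasurableSpace (Ω × B) := borel _
  have : BorelSpace (Ω × B) := ⟨rfl⟩
  obtain ⟨μ, hfin, -, hmass, hμ⟩ := exists_measure_forall_le_integral
    ((convex_convexHull ℝ (w '' Set.Ici N)).is_linear_image (dualBallPairing Ω Y).isLinear)
    (mul_pos two_pos hδ) (by
      rintro _ ⟨v, hv, rfl⟩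
      obtain ⟨ω, hω⟩ := hcon v hv
      obtain ⟨φ, hφ1, hφ⟩ := exists_dual_vector'' ℝ (v ω)
      exact ⟨(ω, ⟨StrongDual.toWeakDual φ, mem_closedBall_zero_iff.2 hφ1⟩),
        hω.le.trans_eq hφ.symm⟩)
  have hle : ∀ (p : Ω × B) (y : Y), |(p.2 : WeakDual ℝ Y) y| ≤ ‖y‖ := fun p y => by
    have h := (WeakDual.toStrongDual (p.2 : WeakDual ℝ Y)).le_of_opNorm_le
      (mem_closedBall_zero_iff.1 p.2.2) y
    rwa [one_mul] at h
  have hcont : ∀ n, Continuous fun p => max (dualBallPairing Ω Y (w n) p) δ := fun n =>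
    (dualBallPairing Ω Y (w n)).continuous.max continuous_const
  have hlim : Tendsto (fun n => ∫ p, max (dualBallPairing Ω Y (w n) p) δ ∂μ) atTop
      (𝓝 (∫ _, δ ∂μ)) := by
    refine tendsto_integral_of_dominated_convergence (fun _ => max M δ)
      (fun n => (integrable_of_continuous_of_compactSpace μ (hcont n)).aestronglyMeasurable)
      (integrable_const _) (fun n => ae_of_all _ fun p => ?_) (ae_of_all _ fun p => ?_)
    · rw [Real.norm_of_nonneg (le_max_of_le_right hδ.le)]
      exact max_le_max_right _ ((le_abs_self _).trans ((hle p _).trans (hw n p.1)))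
    · have h1 := (hwz p.1 (WeakDual.toStrongDual (p.2 : WeakDual ℝ Y))).max
        (tendsto_const_nhds (x := δ))
      rwa [max_eq_right] at h1
      exact (le_abs_self _).trans ((hle p _).trans (hz p.1))
  have hge : 2 * δ ≤ ∫ _, δ ∂μ := by
    refine ge_of_tendsto hlim ((eventually_ge_atTop N).mono fun n hn => ?_)
    refine (hμ _ ⟨w n, subset_convexHull ℝ _ ⟨n, hn, rfl⟩, rfl⟩).trans ?_
    exact integral_mono
      (integrable_of_continuous_of_compactSpace μ (dualBallPairing Ω Y (w n)).continuous)
      (integrable_of_continuous_of_compactSpace μ (hcont n)) fun p => le_max_left _ _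
  rw [integral_const, smul_eq_mul] at hge
  nlinarith

variable {Ω : Type*} [TopologicalSpace Ω] [CompactSpace Ω] [MeasurableSpace Ω] [BorelSpace Ω]
  [CompleteSpace Y] [TopologicalSpace.SeparableSpace Y]

/-- A bounded sequence of continuous functions with values in a separable reflexive space has
convex blocks converging weakly almost everywhere. -/
theorem exists_convexHull_tail_tendsto_weakly
    (hY : Function.Surjective (NormedSpace.inclusionInDoubleDual ℝ Y))
    (μ : Measure Ω) [IsFiniteMeasure μ] {u : ℕ → C(Ω, Y)} {M : ℝ} (hM : 0 ≤ M)
    (hu : ∀ n ω, ‖u n ω‖ ≤ M) :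
    ∃ v : ℕ → C(Ω, Y), (∀ n, v n ∈ convexHull ℝ (u '' Set.Ici n)) ∧
      ∃ h : Ω → Y, AEStronglyMeasurable h μ ∧
        ∀ᵐ ω ∂μ, ∀ φ : StrongDual ℝ Y, Tendsto (fun n => φ (v n ω)) atTop (𝓝 (φ (h ω))) := by
  borelize Y
  have : SecondCountableTopology Y := UniformSpace.secondCountable_of_separable Y
  obtain ⟨J, hJ⟩ := exists_injective_clm_lp (V := Y)
  let L : C(Ω, Y) →L[ℝ] Lp (lp (fun _ : ℕ => ℝ) 2) 2 μ :=
    (J.compLpL 2 μ).comp (ContinuousMap.toLp 2 μ ℝ)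
  have hL : ∀ v : C(Ω, Y), L v =ᵐ[μ] fun ω => J (v ω) := fun v => by
    filter_upwards [ContinuousLinearMap.coeFn_compLp J (ContinuousMap.toLp 2 μ ℝ v),
      ContinuousMap.coeFn_toLp (p := 2) (𝕜 := ℝ) μ v] with ω h1 h2
    rw [h2] at h1
    exact h1
  obtain ⟨g, hg⟩ := exists_forall_mem_closure_convexHull_tail (fun n => L (u n))
    (M := ‖L‖ * M) fun n => L.le_opNorm_of_le ((ContinuousMap.norm_le _ hM).2 (hu n))
  have hv : ∀ n : ℕ, ∃ v ∈ convexHull ℝ (u '' Set.Ici n), dist (L v) g < 1 / (n + 1 : ℝ) :=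
    fun n => by
      obtain ⟨y, hy, hyg⟩ := Metric.mem_closure_iff.1 (hg n) (1 / (n + 1 : ℝ)) (by positivity)
      rw [← Set.image_image L u, ← ContinuousLinearMap.coe_coe, ← LinearMap.image_convexHull] at hy
      obtain ⟨v, hv, rfl⟩ := hy
      exact ⟨v, hv, by rwa [dist_comm]⟩
  choose v hvu hvg using hv
  have hLv : Tendsto (fun n => L (v n)) atTop (𝓝 g) := tendsto_iff_dist_tendsto_zero.2
    (squeeze_zero (fun _ => dist_nonneg) (fun n => (hvg n).le)
      tendsto_one_div_add_atTop_nhds_zero_nat)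
  obtain ⟨ns, hns, hae⟩ := (tendstoInMeasure_of_tendsto_Lp hLv).exists_seq_tendsto_ae
  have hvM : ∀ n ω, ‖v n ω‖ ≤ M := fun n ω => by
    have h1 : convexHull ℝ (u '' Set.Ici n) ⊆ Metric.closedBall 0 M :=
      convexHull_min (by
        rintro _ ⟨k, -, rfl⟩
        exact mem_closedBall_zero_iff.2 ((ContinuousMap.norm_le _ hM).2 (hu k)))
        (convex_closedBall _ _)
    exact ((v n).norm_coe_le_norm ω).trans (mem_closedBall_zero_iff.1 (h1 (hvu n)))
  have hweak : ∀ᵐ ω ∂μ, ∃ y, J y = g ω ∧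
      ∀ φ : StrongDual ℝ Y, Tendsto (fun n => φ (v (ns n) ω)) atTop (𝓝 (φ y)) := by
    filter_upwards [hae, ae_all_iff.2 fun n => hL (v n)] with ω hω hLω
    simp only [hLω] at hω
    have hult : ∀ U : Ultrafilter ℕ, (U : Filter ℕ) ≤ atTop → ∃ y, J y = g ω ∧
        ∀ φ : StrongDual ℝ Y, Tendsto (fun n => φ (v (ns n) ω)) U (𝓝 (φ y)) := fun U hU => by
      obtain ⟨y, hy⟩ := exists_weak_limit_of_ultrafilter hY U (fun n => v (ns n) ω)
        fun n => hvM _ _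
      refine ⟨y, ?_, hy⟩
      refine ext_inner_left ℝ fun x => ?_
      have h1 := hy ((innerSL ℝ x).comp J)
      have h2 : Tendsto (fun n => innerSL ℝ x (J (v (ns n) ω))) U (𝓝 (innerSL ℝ x (g ω))) :=
        ((innerSL ℝ x).continuous.tendsto _).comp (hω.mono_left hU)
      exact tendsto_nhds_unique h1 h2
    obtain ⟨y, hy, -⟩ := hult (hyperfilter ℕ) Nat.hyperfilter_le_atTop
    refine ⟨y, hy, fun φ => tendsto_iff_ultrafilter _ _ _ |>.2 fun U hU => ?_⟩
    obtain ⟨y', hy', hφ⟩ := hult U hU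
    rw [hJ (hy.trans hy'.symm)]
    exact hφ φ
  classical
  let h : Ω → Y := fun ω => if hω : ∃ y, J y = g ω ∧
    ∀ φ : StrongDual ℝ Y, Tendsto (fun n => φ (v (ns n) ω)) atTop (𝓝 (φ y)) then hω.choose else 0
  have hh : ∀ᵐ ω ∂μ, J (h ω) = g ω ∧
      ∀ φ : StrongDual ℝ Y, Tendsto (fun n => φ (v (ns n) ω)) atTop (𝓝 (φ (h ω))) := by
    filter_upwards [hweak] with ω hω
    simp only [h, dif_pos hω]
    exact hω.choose_spec
  refine ⟨fun n => v (ns n), fun n => convexHull_mono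
    (Set.image_mono (Set.Ici_subset_Ici.2 (hns.id_le n))) (hvu _), h, ?_,
    hh.mono fun ω => And.right⟩
  borelize ↥(lp (fun _ : ℕ => ℝ) 2)
  have hemb : MeasurableEmbedding J := J.continuous.measurableEmbedding hJ
  refine (hemb.aemeasurable_comp_iff.1 ?_).aestronglyMeasurable
  exact (Lp.aestronglyMeasurable g).aemeasurable.congr (hh.mono fun ω hω => hω.1.symm)

end Blocks

section L1Blocks

variable {Y Ω : Type*} [NormedAddCommGroup Y] [NormedSpace ℝ Y] [TopologicalSpace Ω]

/-- A form of `exists_mem_convexHull_tail_forall_norm_le` relative to a compact subset, where the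
sequence is compared with a continuous function. -/
theorem exists_mem_convexHull_tail_forall_norm_sub_le [T2Space Ω] [CompactSpace Ω] {K : Set Ω}
    (hK : IsCompact K) {v : ℕ → C(Ω, Y)} {M δ : ℝ} (hδ : 0 < δ) (hv : ∀ n ω, ‖v n ω‖ ≤ M)
    (c : C(Ω, Y)) {h : Ω → Y} (hc : ∀ ω ∈ K, ‖h ω - c ω‖ ≤ δ)
    (hvh : ∀ ω ∈ K, ∀ φ : StrongDual ℝ Y, Tendsto (fun n => φ (v n ω)) atTop (𝓝 (φ (h ω))))
    (N : ℕ) : ∃ w ∈ convexHull ℝ (v '' Set.Ici N), ∀ ω ∈ K, ‖w ω - c ω‖ ≤ 2 * δ := by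
  have : CompactSpace K := isCompact_iff_compactSpace.1 hK
  let L : C(Ω, Y) →ₗ[ℝ] C(K, Y) :=
    { toFun := fun w => w.restrict K
      map_add' := fun _ _ => rfl
      map_smul' := fun _ _ => rfl }
  let A : C(Ω, Y) →ᵃ[ℝ] C(K, Y) := L.toAffineMap - AffineMap.const ℝ _ (c.restrict K)
  obtain ⟨w', hw', hle⟩ := exists_mem_convexHull_tail_forall_norm_le (Y := Y)
    (w := fun n => A (v n)) (M := M + ‖c‖) (z := fun ω : K => h ω - c ω) hδ
    (fun n ω => (norm_sub_le _ _).trans (add_le_add (hv n ω) (c.norm_coe_le_norm ω)))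
    (fun ω => hc ω ω.2) (fun ω φ => by
      rw [map_sub]
      exact ((hvh ω ω.2 φ).sub_const (φ (c ω))).congr fun n => (map_sub φ _ _).symm) N
  rw [← Set.image_image A v, ← AffineMap.image_convexHull] at hw'
  obtain ⟨w, hw, rfl⟩ := hw'
  exact ⟨w, hw, fun ω hω => hle ⟨ω, hω⟩⟩

variable [CompactSpace Ω] [T2Space Ω] [MeasurableSpace Ω] [BorelSpace Ω]

/-- An integrable function is uniformly close to a continuous one on a large compact set, which may
be chosen inside a set of full measure. -/
theorem exists_continuousMap_isCompact_norm_sub_le {μ : Measure Ω} [IsFiniteMeasure μ] [μ.Regular]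
    {h : Ω → Y} (hh : Integrable h μ) {p : Ω → Prop} (hp : ∀ᵐ ω ∂μ, p ω) {δ : ℝ} (hδ : 0 < δ) :
    ∃ (c : C(Ω, Y)) (K : Set Ω), IsCompact K ∧ μ.real Kᶜ ≤ 2 * δ ∧
      ∀ ω ∈ K, ‖h ω - c ω‖ ≤ δ ∧ p ω := by
  obtain ⟨c, hc, hci⟩ := hh.exists_boundedContinuous_integral_sub_le (mul_pos hδ hδ)
  have hmarkov := (mul_meas_ge_le_integral_of_nonneg (ae_of_all _ fun ω => norm_nonneg _)
    (hh.sub hci).norm δ).trans hc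
  rw [mul_le_mul_iff_right₀ hδ] at hmarkov
  let Z : Set Ω := toMeasurable μ ({ω | δ ≤ ‖(h - ⇑c) ω‖} ∪ {ω | ¬ p ω})
  have hZm : MeasurableSet Z := measurableSet_toMeasurable _ _
  have hZ : μ.real Z ≤ δ := by
    rw [measureReal_def, measure_toMeasurable, ← measureReal_def]
    refine (measureReal_union_le _ _).trans ?_
    have h0 : μ.real {ω | ¬ p ω} = 0 := by rw [measureReal_def, ae_iff.1 hp, ENNReal.toReal_zero]
    rwa [h0, add_zero]
  obtain ⟨K, hKZ, hK, hKμ⟩ := hZm.compl.exists_isCompact_sdiff_lt (measure_ne_top μ _)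
    (ε := ENNReal.ofReal δ) (by simpa using hδ)
  refine ⟨c.toContinuousMap, K, hK, ?_, fun ω hω => ?_⟩
  · have hsub : Kᶜ ⊆ Z ∪ (Zᶜ \ K) := fun ω hω => by
      by_cases hωZ : ω ∈ Z
      exacts [Or.inl hωZ, Or.inr ⟨hωZ, hω⟩]
    have h1 : μ.real (Zᶜ \ K) ≤ δ := ENNReal.toReal_le_of_le_ofReal hδ.le hKμ.le
    linarith [(measureReal_mono hsub).trans (measureReal_union_le (μ := μ) _ _)]
  · have h1 : ω ∉ {ω | δ ≤ ‖(h - ⇑c) ω‖} ∪ {ω | ¬ p ω} :=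
      fun hω' => hKZ hω (subset_toMeasurable _ _ hω')
    simp only [Set.mem_union, Set.mem_ofPred_eq, not_or, not_le, not_not] at h1
    exact ⟨h1.1.le, h1.2⟩

/-- A bounded sequence of continuous functions with values in a separable reflexive space has
convex blocks converging in `L¹`. -/
theorem exists_integrable_forall_exists_mem_convexHull_tail
    [CompleteSpace Y] [TopologicalSpace.SeparableSpace Y]
    (hY : Function.Surjective (NormedSpace.inclusionInDoubleDual ℝ Y))
    (μ : Measure Ω) [IsFiniteMeasure μ] [μ.Regular] {u : ℕ → C(Ω, Y)} {M : ℝ} (hM : 0 ≤ M)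
    (hu : ∀ n ω, ‖u n ω‖ ≤ M) :
    ∃ h : Ω → Y, Integrable h μ ∧ ∀ (N : ℕ) (ε : ℝ), 0 < ε →
      ∃ v ∈ convexHull ℝ (u '' Set.Ici N), ∫ ω, ‖v ω - h ω‖ ∂μ ≤ ε := by
  obtain ⟨v, hvu, h, hmeas, hvh⟩ := exists_convexHull_tail_tendsto_weakly hY μ hM hu
  have hull : ∀ w ∈ convexHull ℝ (Set.range u), ∀ ω, ‖w ω‖ ≤ M := fun w hw ω => by
    have h1 : convexHull ℝ (Set.range u) ⊆ Metric.closedBall 0 M :=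
      convexHull_min (by
        rintro _ ⟨k, rfl⟩
        exact mem_closedBall_zero_iff.2 ((ContinuousMap.norm_le _ hM).2 (hu k)))
        (convex_closedBall _ _)
    exact (w.norm_coe_le_norm ω).trans (mem_closedBall_zero_iff.1 (h1 hw))
  have hvM : ∀ n ω, ‖v n ω‖ ≤ M := fun n =>
    hull _ (convexHull_mono (Set.image_subset_range _ _) (hvu n))
  have hhM : ∀ᵐ ω ∂μ, ‖h ω‖ ≤ M := hvh.mono fun ω hω => by
    obtain ⟨φ, hφ1, hφ⟩ := exists_dual_vector'' ℝ (h ω)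
    have h1 : φ (h ω) = ‖h ω‖ := hφ
    rw [← h1]
    refine le_of_tendsto (hω φ) (Eventually.of_forall fun n => ?_)
    exact (le_abs_self _).trans ((φ.le_of_opNorm_le hφ1 _).trans ((one_mul _).trans_le (hvM n ω)))
  have hint : Integrable h μ := Integrable.of_bound hmeas M hhM
  refine ⟨h, hint, fun N ε hε => ?_⟩
  set m := μ.real Set.univ
  have hm : 0 ≤ m := measureReal_nonneg
  have hden : 0 < 3 * m + 4 * M + 1 := by positivity
  obtain ⟨c, K, hK, hKμ, hc⟩ := exists_continuousMap_isCompact_norm_sub_le hint hvh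
    (div_pos hε hden)
  set δ := ε / (3 * m + 4 * M + 1) with hδ
  have hδ0 : 0 < δ := div_pos hε hden
  obtain ⟨w, hw, hwc⟩ := exists_mem_convexHull_tail_forall_norm_sub_le hK hδ0 hvM c
    (fun ω hω => (hc ω hω).1) (fun ω hω => (hc ω hω).2) N
  have hwu : w ∈ convexHull ℝ (u '' Set.Ici N) := by
    refine convexHull_min ?_ (convex_convexHull ℝ _) hw
    rintro _ ⟨k, hk, rfl⟩
    exact convexHull_mono (Set.image_mono (Set.Ici_subset_Ici.2 hk)) (hvu k)
  refine ⟨w, hwu, ?_⟩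
  have hKm : MeasurableSet Kᶜ := hK.measurableSet.compl
  have hbound : ∀ᵐ ω ∂μ, ‖w ω - h ω‖ ≤ 3 * δ + Kᶜ.indicator (fun _ => 2 * M) ω := by
    filter_upwards [hhM] with ω hω
    by_cases hωK : ω ∈ K
    · rw [Set.indicator_of_notMem (Set.notMem_compl_iff.2 hωK)]
      linarith [norm_sub_le_norm_sub_add_norm_sub (w ω) (c ω) (h ω), hwc ω hωK, (hc ω hωK).1,
        norm_sub_rev (h ω) (c ω)]
    · rw [Set.indicator_of_mem (Set.mem_compl hωK)]
      linarith [norm_sub_le (w ω) (h ω),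
        hull w (convexHull_mono (Set.image_subset_range _ _) hwu) ω]
  calc ∫ ω, ‖w ω - h ω‖ ∂μ
      ≤ ∫ ω, (3 * δ + Kᶜ.indicator (fun _ => 2 * M) ω) ∂μ :=
        integral_mono_ae
          ((integrable_of_continuous_of_compactSpace μ w.continuous).sub hint).norm
          ((integrable_const _).add ((integrable_const _).indicator hKm)) hbound
    _ = m * (3 * δ) + μ.real Kᶜ * (2 * M) := by
        rw [integral_add (integrable_const _) ((integrable_const _).indicator hKm),
          integral_indicator_const _ hKm, integral_const, smul_eq_mul, smul_eq_mul]
    _ ≤ m * (3 * δ) + 2 * δ * (2 * M) := by gcongr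
    _ ≤ δ * (3 * m + 4 * M + 1) := by linarith
    _ = ε := div_mul_cancel₀ _ hden.ne'

end L1Blocks

section Dominated

variable {X Ω : Type*} [NormedAddCommGroup X] [NormedSpace ℝ X] [CompleteSpace X]
  [TopologicalSpace Ω] [CompactSpace Ω] [T2Space Ω] [MeasurableSpace Ω] [BorelSpace Ω]

/-- A bounded sequence of continuous functions with values in a reflexive space has convex blocks
that are Cauchy in `L¹`. -/
theorem exists_seq_mem_convexHull_tail_integral_norm_sub_le
    (hX : Function.Surjective (NormedSpace.inclusionInDoubleDual ℝ X))
    (μ : Measure Ω) [IsFiniteMeasure μ] [μ.Regular] {u : ℕ → C(Ω, X)} {M : ℝ} (hM : 0 ≤ M)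
    (hu : ∀ n ω, ‖u n ω‖ ≤ M) :
    ∃ v : ℕ → C(Ω, X), (∀ n, v n ∈ convexHull ℝ (u '' Set.Ici n)) ∧
      ∀ m n, ∫ ω, ‖v m ω - v n ω‖ ∂μ ≤ 1 / (m + 1 : ℝ) + 1 / (n + 1 : ℝ) := by
  let D : Set X := ⋃ n, Set.range (u n)
  let Y : Submodule ℝ X := (Submodule.span ℝ D).topologicalClosure
  have hYc : IsClosed (Y : Set X) := Submodule.isClosed_topologicalClosure _
  have hD : TopologicalSpace.IsSeparable D :=
    TopologicalSpace.IsSeparable.iUnion fun n => (isCompact_range (u n).continuous).isSeparable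
  have hsep : TopologicalSpace.SeparableSpace Y :=
    TopologicalSpace.IsSeparable.separableSpace (hD.span.closure)
  have : CompleteSpace Y := hYc.completeSpace_coe
  have hmem : ∀ n ω, u n ω ∈ Y := fun n ω =>
    Submodule.le_topologicalClosure _ (Submodule.subset_span (Set.mem_iUnion.2 ⟨n, ω, rfl⟩))
  let u' : ℕ → C(Ω, Y) := fun n => ⟨fun ω => ⟨u n ω, hmem n ω⟩, by fun_prop⟩
  obtain ⟨h, hh, hblock⟩ := exists_integrable_forall_exists_mem_convexHull_tail
    (surjective_inclusionInDoubleDual_of_isClosed hX Y hYc) μ (u := u') hM hu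
  choose v hv hvh using fun n : ℕ => hblock n (1 / (n + 1 : ℝ)) Nat.one_div_pos_of_nat
  let L : C(Ω, Y) →ₗ[ℝ] C(Ω, X) := (Y.subtypeL.compLeftContinuous ℝ Ω)
  refine ⟨fun n => L (v n), fun n => ?_, fun m n => ?_⟩
  · have h1 : L '' convexHull ℝ (u' '' Set.Ici n) = convexHull ℝ (u '' Set.Ici n) := by
      rw [L.image_convexHull, Set.image_image]
      rfl
    rw [← h1]
    exact ⟨v n, hv n, rfl⟩
  · have hi : ∀ k, Integrable (fun ω => ‖v k ω - h ω‖) μ := fun k =>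
      ((integrable_of_continuous_of_compactSpace μ (v k).continuous).sub hh).norm
    calc ∫ ω, ‖L (v m) ω - L (v n) ω‖ ∂μ
        ≤ ∫ ω, (‖v m ω - h ω‖ + ‖v n ω - h ω‖) ∂μ := by
          refine integral_mono (integrable_of_continuous_of_compactSpace μ (by fun_prop))
            ((hi m).add (hi n)) fun ω => ?_
          change ‖v m ω - v n ω‖ ≤ _
          rw [norm_sub_rev (v n ω)]
          exact norm_sub_le_norm_sub_add_norm_sub _ _ _
      _ ≤ _ := by
          rw [integral_add (hi m) (hi n)]
          exact add_le_add (hvh m) (hvh n)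

variable {P E : Type*} [NormedAddCommGroup P] [NormedSpace ℝ P] [NormedAddCommGroup E]
  [NormedSpace ℝ E] [CompleteSpace E]

/-- If `T` is dominated by the `L^q`-norm of a bounded linear map into the continuous functions with
values in a reflexive space, then the image of every sequence of the unit ball has a point common to
the closed convex hulls of its tails. -/
theorem exists_forall_mem_closure_convexHull_of_domination
    (hX : Function.Surjective (NormedSpace.inclusionInDoubleDual ℝ X))
    (μ : Measure Ω) [IsFiniteMeasure μ] [μ.Regular] (T : P →ₗ[ℝ] E) (b : P →ₗ[ℝ] C(Ω, X))
    {M c q : ℝ} (hM : 0 ≤ M) (hb : ∀ f ω, ‖b f ω‖ ≤ M * ‖f‖) (hc : 0 ≤ c) (hq : 1 ≤ q)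
    (hT : ∀ f, ‖T f‖ ^ q ≤ c * ∫ ω, ‖b f ω‖ ^ q ∂μ) {f : ℕ → P} (hf : ∀ n, ‖f n‖ ≤ 1) :
    ∃ x, ∀ n, x ∈ closure (convexHull ℝ ((fun k => T (f k)) '' Set.Ici n)) := by
  have hq0 : 0 < q := by linarith
  obtain ⟨v, hv, hvi⟩ := exists_seq_mem_convexHull_tail_integral_norm_sub_le hX μ
    (u := fun n => b (f n)) hM
    fun n ω => (hb _ ω).trans (mul_le_of_le_one_right hM (hf n))
  have hg : ∀ n, ∃ g ∈ convexHull ℝ (f '' Set.Ici n), b g = v n := fun n => by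
    have h1 := hv n
    rwa [← Set.image_image b f, ← b.image_convexHull] at h1
  choose g hg hgv using hg
  have hg1 : ∀ n, ‖g n‖ ≤ 1 := fun n => by
    have h1 : convexHull ℝ (f '' Set.Ici n) ⊆ Metric.closedBall 0 1 :=
      convexHull_min (by
        rintro _ ⟨k, -, rfl⟩
        exact mem_closedBall_zero_iff.2 (hf k)) (convex_closedBall _ _)
    exact mem_closedBall_zero_iff.1 (h1 (hg n))
  let C : ℝ := c * (2 * M) ^ (q - 1)
  have hC : 0 ≤ C := by positivity
  have hdiff : ∀ m n, ‖T (g m) - T (g n)‖ ^ q ≤ C * (1 / (m + 1 : ℝ) + 1 / (n + 1 : ℝ)) :=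
    fun m n => by
      have hpt : ∀ ω, ‖b (g m - g n) ω‖ ^ q ≤ (2 * M) ^ (q - 1) * ‖v m ω - v n ω‖ := fun ω => by
        have h1 : b (g m - g n) ω = v m ω - v n ω := by
          rw [map_sub, hgv, hgv, ContinuousMap.sub_apply]
        have h2 : ‖v m ω - v n ω‖ ≤ 2 * M := by
          rw [← h1]
          refine (hb _ ω).trans ?_
          nlinarith [norm_sub_le (g m) (g n), hg1 m, hg1 n]
        rw [h1]
        calc ‖v m ω - v n ω‖ ^ q = ‖v m ω - v n ω‖ ^ (q - 1) * ‖v m ω - v n ω‖ := by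
              rw [← Real.rpow_add_one' (norm_nonneg _) (by simpa using hq0.ne'), sub_add_cancel]
          _ ≤ _ := by
              gcongr
      rw [← map_sub]
      calc ‖T (g m - g n)‖ ^ q ≤ c * ∫ ω, ‖b (g m - g n) ω‖ ^ q ∂μ := hT _
        _ ≤ c * ∫ ω, (2 * M) ^ (q - 1) * ‖v m ω - v n ω‖ ∂μ := by
            refine mul_le_mul_of_nonneg_left
              (integral_mono (integrable_of_continuous_of_compactSpace μ ?_)
                (integrable_of_continuous_of_compactSpace μ (by fun_prop)) hpt) hc
            exact (b (g m - g n)).continuous.norm.rpow_const fun _ => Or.inr hq0.le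
        _ ≤ c * ((2 * M) ^ (q - 1) * (1 / (m + 1 : ℝ) + 1 / (n + 1 : ℝ))) := by
            rw [integral_const_mul]
            gcongr
            exact hvi m n
        _ = _ := (mul_assoc _ _ _).symm
  have hcauchy : CauchySeq fun n => T (g n) := by
    refine cauchySeq_of_le_tendsto_0 (fun N : ℕ => (C * (2 * (1 / (N + 1 : ℝ)))) ^ (1 / q))
      (fun m n N hm hn => ?_) ?_
    · rw [dist_eq_norm, one_div q,
        Real.le_rpow_inv_iff_of_pos (norm_nonneg _) (by positivity) hq0, two_mul]
      refine (hdiff m n).trans ?_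
      gcongr
    · have h1 := ((tendsto_one_div_add_atTop_nhds_zero_nat (𝕜 := ℝ)).const_mul 2).const_mul C
      rw [mul_zero, mul_zero] at h1
      have h2 := h1.rpow_const (p := 1 / q) (Or.inr (by positivity))
      rwa [Real.zero_rpow (by positivity)] at h2
  obtain ⟨x, hx⟩ := cauchySeq_tendsto_of_complete hcauchy
  refine ⟨x, fun n => mem_closure_of_tendsto hx ((eventually_ge_atTop n).mono fun m hm => ?_)⟩
  refine convexHull_mono (Set.image_mono (Set.Ici_subset_Ici.2 hm)) ?_
  rw [← Set.image_image T f, ← T.image_convexHull]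
  exact ⟨g m, hg m, rfl⟩

end Dominated

/-- The domination inequality defining a summing operator is attained at a point, once the unit ball
of `R` is represented by a compact space `Ω` of evaluations. -/
theorem IsSumming.exists_sum_le {F G X E : Type*} [NormedAddCommGroup F] [NormedSpace ℝ F]
    [NormedAddCommGroup G] [NormedSpace ℝ G] [NormedAddCommGroup X] [NormedSpace ℝ X]
    [NormedAddCommGroup E] [NormedSpace ℝ E] {B : F →L[ℝ] G →L[ℝ] X} {P : Submodule ℝ F}
    {R : Submodule ℝ G} {q K : ℝ} {T : P →L[ℝ] E} (hT : IsSumming B P R q T K)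
    (hK : 0 ≤ K) (hq : 0 < q)
    {Ω : Type*} [TopologicalSpace Ω] [CompactSpace Ω] {r : subBall R → Ω} {b : P → C(Ω, X)}
    (hb : ∀ f g, b f (r g) = B (f : F) g) {n : ℕ} (f : Fin n → P) :
    ∃ ω, ∑ i, ‖T (f i)‖ ^ q ≤ K ^ q * ∑ i, ‖b (f i) ω‖ ^ q := by
  have hcont : Continuous fun ω => ∑ i, ‖b (f i) ω‖ ^ q :=
    continuous_finsetSum _ fun i _ => (b (f i)).continuous.norm.rpow_const fun _ => Or.inr hq.le
  have : Nonempty Ω := ⟨r ⟨0, R.zero_mem, by simp⟩⟩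
  obtain ⟨ω, -, hω⟩ := isCompact_univ.exists_isMaxOn Set.univ_nonempty hcont.continuousOn
  refine ⟨ω, ?_⟩
  have hsup : sSup ((fun g => (∑ i, ‖B (f i : F) g‖ ^ q) ^ (1 / q)) '' subBall R) ≤
      (∑ i, ‖b (f i) ω‖ ^ q) ^ (1 / q) := by
    refine Real.sSup_le ?_ (by positivity)
    rintro _ ⟨g, hg, rfl⟩
    have h1 := hω (Set.mem_univ (r ⟨g, hg⟩))
    simp only [Set.mem_ofPred_eq, hb] at h1
    exact Real.rpow_le_rpow (by positivity) h1 (by positivity)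
  have h2 := (hT n f).trans (mul_le_mul_of_nonneg_left hsup hK)
  have h3 := Real.rpow_le_rpow (by positivity) h2 hq.le
  rwa [Real.mul_rpow hK (by positivity), ← Real.rpow_mul (by positivity),
    ← Real.rpow_mul (by positivity), one_div_mul_cancel hq.ne', Real.rpow_one, Real.rpow_one] at h3

/-- If `X` is reflexive, `P ⊆ S ⊆ F` and the closed unit ball of `R ⊆ G` is compact for
the topology `τ_B(S)`, then every `(q,R)`-summing operator `T : P → E` is weakly
compact: the image under `T` of the closed unit ball of `P` is relatively compact for
the weak topology of `E`. -/
theorem summing_weakly_compact (B : F →L[ℝ] G →L[ℝ] X) (P S : Submodule ℝ F)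
    (R : Submodule ℝ G) (q : ℝ) (hq : 1 ≤ q) (hPS : P ≤ S)
    (hX : Function.Surjective (NormedSpace.inclusionInDoubleDual ℝ X))
    (hRcomp : @IsCompact G (tauB B S) (subBall R))
    (T : P →L[ℝ] E) (hT : ∃ K, 0 ≤ K ∧ IsSumming B P R q T K) :
    IsCompact (closure ((fun f : P => toWeakSpace ℝ E (T f)) '' {f : P | ‖f‖ ≤ 1})) := by
  obtain ⟨K, hK, hT⟩ := hT
  let Ψ : G → S → X := fun g f => B (f : F) g
  have hcomp : IsCompact (Ψ '' subBall R) :=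
    @IsCompact.image G (S → X) (tauB B S) _ _ Ψ hRcomp (@continuous_induced_dom G (S → X) Ψ _)
  let Ω := Ψ '' subBall R
  have : CompactSpace Ω := isCompact_iff_compactSpace.1 hcomp
  let _ : MeasurableSpace Ω := borel Ω
  have : BorelSpace Ω := ⟨rfl⟩
  let b : P →ₗ[ℝ] C(Ω, X) :=
    { toFun := fun f => ⟨fun ω => (ω : S → X) ⟨f, hPS f.2⟩,
        (continuous_apply _).comp continuous_subtype_val⟩
      map_add' := fun f f' => by
        ext ⟨_, g, -, rfl⟩
        simp [Ψ]
      map_smul' := fun c f => by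
        ext ⟨_, g, -, rfl⟩
        simp [Ψ] }
  have hb : ∀ f ω, ‖b f ω‖ ≤ ‖B‖ * ‖f‖ := by
    rintro f ⟨_, g, hg, rfl⟩
    exact (B.le_opNorm₂ f g).trans (mul_le_of_le_one_right (by positivity) hg.2)
  obtain ⟨μ, _, _, -, hμ⟩ := exists_measure_pietsch_domination (T : P →ₗ[ℝ] E) b hq fun n f =>
    hT.exists_sum_le hK (by linarith) (r := fun g => (⟨Ψ g, g, g.2, rfl⟩ : Ω))
      (b := b) (fun _ _ => rfl) f
  rw [← Set.image_image (toWeakSpace ℝ E) T]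
  refine isCompact_closure_toWeakSpace_of_forall_seq ?_ fun a ha => ?_
  · refine isBounded_iff_forall_norm_le.2 ⟨‖T‖, ?_⟩
    rintro _ ⟨f, hf, rfl⟩
    exact (T.le_opNorm f).trans (mul_le_of_le_one_right (norm_nonneg _) hf)
  · choose f hf hfa using ha
    obtain rfl : (fun n => T (f n)) = a := funext hfa
    exact exists_forall_mem_closure_convexHull_of_domination hX μ (T : P →ₗ[ℝ] E) b (norm_nonneg B)
      hb (by positivity) hq hμ hf
end
end

section
/- Let P ⊆ F be a subspace and let T : P → E be an isomorphism onto its range, i.e. there are constants 0 < c ≤ C such that c‖f‖ ≤ ‖T f‖ ≤ C‖f‖ for all f ∈ P. Suppose there exist subspaces R ⊆ G and S ⊆ F with P ⊆ S such that: (a) R is B-norming for P with some constant; (b) the closed unit ball of P is τ_B(R)-sequentially compact, i.e. every norm-bounded sequence (f_n) in P has a subsequence (f_{n_k}) such that (B(f_{n_k}, g))_k is a Cauchy sequence in X for every g ∈ R; (c) the closed unit ball of R is compact in the topology τ_B(S); and (d) T is (q,R)-summing with respect to B for some 1 ≤ q < ∞. Then P is finite-dimensional. -/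
open scoped BigOperators

noncomputable section

variable {F G X E : Type*}
variable [NormedAddCommGroup F] [NormedSpace ℝ F] [CompleteSpace F]
variable [NormedAddCommGroup G] [NormedSpace ℝ G] [CompleteSpace G]
variable [NormedAddCommGroup X] [NormedSpace ℝ X] [CompleteSpace X]
variable [NormedAddCommGroup E] [NormedSpace ℝ E] [CompleteSpace E]

open MeasureTheory in
/-- A positive continuous linear functional on `C(Y, ℝ)`, with `Y` compact Hausdorff, is integration
against a finite Borel measure. -/
theorem exists_isFiniteMeasure_integral_eq {Y : Type*} [TopologicalSpace Y] [CompactSpace Y]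
    [T2Space Y] [MeasurableSpace Y] [BorelSpace Y] (φ : C(Y, ℝ) →L[ℝ] ℝ)
    (hφ : ∀ f : C(Y, ℝ), 0 ≤ f → 0 ≤ φ f) :
    ∃ μ : Measure Y, IsFiniteMeasure μ ∧ ∀ f : C(Y, ℝ), ∫ y, f y ∂μ = φ f := by
  let L : CompactlySupportedContinuousMap Y ℝ →ₗ[ℝ] ℝ :=
    { toFun := fun f => φ f.toContinuousMap
      map_add' := fun f g => φ.map_add f.toContinuousMap g.toContinuousMap
      map_smul' := fun a f => φ.map_smul a f.toContinuousMap }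
  let Λ : CompactlySupportedContinuousMap Y ℝ →ₚ[ℝ] ℝ :=
    PositiveLinearMap.mk₀ L fun f hf => hφ f.toContinuousMap hf
  exact ⟨RealRMK.rieszMeasure Λ, inferInstance, fun f =>
    RealRMK.integral_rieszMeasure Λ ⟨f, HasCompactSupport.of_compactSpace f⟩⟩

open MeasureTheory Filter Topology in
/-- A uniformly bounded sequence of continuous functions on a compact Hausdorff space which tends
to zero pointwise has convex combinations that are uniformly small from above. -/
theorem exists_convexCombination_lt_of_tendsto_zero {Y : Type*} [TopologicalSpace Y]
    [CompactSpace Y] [T2Space Y] (h : ℕ → C(Y, ℝ)) (M : ℝ) (hM : ∀ k y, ‖h k y‖ ≤ M)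
    (hlim : ∀ y, Tendsto (fun k => h k y) atTop (𝓝 0)) {ε : ℝ} (hε : 0 < ε) :
    ∃ (n : ℕ) (w : Fin n → ℝ) (k : Fin n → ℕ), (∀ i, 0 ≤ w i) ∧ ∑ i, w i = 1 ∧
      ∀ y, ∑ i, w i * h (k i) y < ε := by
  let U : Set C(Y, ℝ) := {f | ∀ y, f y < ε}
  suffices hU : ¬ Disjoint U (convexHull ℝ (Set.range h)) by
    obtain ⟨f, hfU, hf⟩ := Set.not_disjoint_iff.1 hU
    obtain ⟨ι, _, w, z, hw, hw1, hz, rfl⟩ := mem_convexHull_iff_exists_fintype.1 hf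
    choose k hk using hz
    let e := (Fintype.equivFin ι).symm
    refine ⟨Fintype.card ι, w ∘ e, k ∘ e, fun i => hw _, ?_, fun y => ?_⟩
    · rw [← hw1]
      exact e.sum_comp w
    · have := hfU y
      simp only [ContinuousMap.coe_sum, Finset.sum_apply, ContinuousMap.coe_smul, Pi.smul_apply,
        smul_eq_mul, ← hk] at this
      rw [← e.sum_comp] at this
      exact this
  intro hdisj
  have hUo : IsOpen U := by
    have := ContinuousMap.isOpen_setOfPred_mapsTo (X := Y) isCompact_univ (isOpen_Iio (a := ε))
    simpa [U, Set.MapsTo] using this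
  have hUc : Convex ℝ U := by
    intro f hf g hg a b ha hb hab y
    exact convex_Iio ε (hf y) (hg y) ha hb hab
  obtain ⟨φ, s, hφU, hφh⟩ := geometric_hahn_banach_open hUc hUo (convex_convexHull ℝ _) hdisj
  have hs : 0 < s := by
    simpa using hφU 0 fun y => hε
  have hpos : ∀ f : C(Y, ℝ), 0 ≤ f → 0 ≤ φ f := by
    intro f hf
    by_contra! hneg
    have hmem : (s / φ f) • f ∈ U := fun y =>
      (mul_nonpos_of_nonpos_of_nonneg (div_nonpos_of_nonneg_of_nonpos hs.le hneg.le)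
        (hf y)).trans_lt hε
    have := hφU _ hmem
    rw [map_smul, smul_eq_mul, div_mul_cancel₀ _ hneg.ne] at this
    exact lt_irrefl _ this
  let _ : MeasurableSpace Y := borel Y
  have : BorelSpace Y := ⟨rfl⟩
  obtain ⟨μ, _, hμ⟩ := exists_isFiniteMeasure_integral_eq φ hpos
  have hconv : Tendsto (fun k => ∫ y, h k y ∂μ) atTop (𝓝 (∫ _, (0 : ℝ) ∂μ)) :=
    tendsto_integral_of_dominated_convergence (fun _ => M)
      (fun k => (h k).continuous.measurable.aestronglyMeasurable) (integrable_const M)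
      (fun k => ae_of_all _ (hM k)) (ae_of_all _ hlim)
  simp only [hμ, integral_zero] at hconv
  exact hs.not_ge (ge_of_tendsto' hconv fun k => hφh _ (subset_convexHull ℝ _ ⟨k, rfl⟩))

open Filter Topology in
/-- If the closed unit ball of `R` is `τ_B(S)`-compact, then a `(q,R)`-summing operator cannot be
bounded below along a bounded sequence `d` with `B (d k) g → 0` for all `g ∈ R`. -/
theorem IsSumming.exists_norm_lt {B : F →L[ℝ] G →L[ℝ] X} {P S : Submodule ℝ F}
    {R : Submodule ℝ G} {T : P →L[ℝ] E} {q K : ℝ} (hT : IsSumming B P R q T K) (hq : 1 ≤ q)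
    (hK : 0 ≤ K) (hPS : P ≤ S) (hcomp : @IsCompact G (tauB B S) (subBall R)) {d : ℕ → P} {M : ℝ}
    (hd : ∀ k, ‖d k‖ ≤ M) (hlim : ∀ g ∈ R, Tendsto (fun k => B (d k : F) g) atTop (𝓝 0))
    {c : ℝ} (hc : 0 < c) : ∃ k, ‖T (d k)‖ < c := by
  have hq0 : 0 < q := zero_lt_one.trans_le hq
  by_contra! hge
  let Φ : G → S → X := fun g f => B (f : F) g
  have hΦ : @Continuous G (S → X) (tauB B S) _ Φ := continuous_induced_dom
  have hcomp' : IsCompact (Φ '' subBall R) := @IsCompact.image _ _ (tauB B S) _ _ _ hcomp hΦ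
  have : CompactSpace (Φ '' subBall R) := isCompact_iff_compactSpace.1 hcomp'
  let h : ℕ → C(Φ '' subBall R, ℝ) := fun k =>
    ⟨fun u => ‖(u : S → X) ⟨d k, hPS (d k).2⟩‖ ^ q, by
      have : Continuous fun u : Φ '' subBall R => (u : S → X) ⟨d k, hPS (d k).2⟩ :=
        (continuous_apply _).comp continuous_subtype_val
      exact this.norm.rpow_const fun _ => Or.inr hq0.le⟩
  have hM : 0 ≤ M := (norm_nonneg _).trans (hd 0)
  have hbound : ∀ k y, ‖h k y‖ ≤ (‖B‖ * M) ^ q := by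
    rintro k ⟨_, g, hg, rfl⟩
    change ‖‖B (d k : F) g‖ ^ q‖ ≤ _
    rw [Real.norm_of_nonneg (by positivity)]
    gcongr
    calc ‖B (d k : F) g‖ ≤ ‖B‖ * ‖(d k : F)‖ * ‖g‖ := B.le_opNorm₂ _ _
      _ ≤ ‖B‖ * M * 1 := by
        gcongr
        exacts [hd k, hg.2]
      _ = ‖B‖ * M := mul_one _
  have hh : ∀ y, Tendsto (fun k => h k y) atTop (𝓝 0) := by
    rintro ⟨_, g, hg, rfl⟩
    have := (hlim g hg.1).norm.rpow_const (p := q) (Or.inr hq0.le)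
    rwa [norm_zero, Real.zero_rpow hq0.ne'] at this
  let δ : ℝ := c / (K + 1)
  have hδ : 0 < δ := by positivity
  obtain ⟨n, w, k, hw, hw1, hlt⟩ :=
    exists_convexCombination_lt_of_tendsto_zero h _ hbound hh (Real.rpow_pos_of_pos hδ q)
  have hpow : ∀ i (a : ℝ), 0 ≤ a → (w i ^ (1 / q) * a) ^ q = w i * a ^ q := by
    intro i a ha
    rw [Real.mul_rpow (Real.rpow_nonneg (hw i) _) ha, ← Real.rpow_mul (hw i),
      one_div_mul_cancel hq0.ne', Real.rpow_one]
  have hsum := hT n fun i => w i ^ (1 / q) • d (k i)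
  have hnorm : ∀ i, ‖w i ^ (1 / q)‖ = w i ^ (1 / q) := fun i =>
    Real.norm_of_nonneg (Real.rpow_nonneg (hw i) _)
  simp only [map_smul, Submodule.coe_smul, smul_apply, norm_smul, hnorm,
    hpow _ _ (norm_nonneg _)] at hsum
  have hlower : c ≤ (∑ i, w i * ‖T (d (k i))‖ ^ q) ^ (1 / q) := by
    rw [one_div, Real.le_rpow_inv_iff_of_pos hc.le
      (Finset.sum_nonneg fun i _ => mul_nonneg (hw i) (by positivity)) hq0]
    calc c ^ q = ∑ i, w i * c ^ q := by rw [← Finset.sum_mul, hw1, one_mul]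
      _ ≤ ∑ i, w i * ‖T (d (k i))‖ ^ q := by
        gcongr with i
        exacts [hw i, hge (k i)]
  have hupper : sSup ((fun g => (∑ i, w i * ‖B (d (k i) : F) g‖ ^ q) ^ (1 / q)) '' subBall R)
      ≤ δ := by
    refine csSup_le (Set.Nonempty.image _ ⟨0, R.zero_mem, by simp⟩) ?_
    rintro _ ⟨g, hg, rfl⟩
    dsimp only
    rw [one_div, Real.rpow_inv_le_iff_of_pos
      (Finset.sum_nonneg fun i _ => mul_nonneg (hw i) (by positivity)) hδ.le hq0]
    exact (hlt ⟨Φ g, g, hg, rfl⟩).le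
  have hlast : c ≤ K * δ := hlower.trans (hsum.trans (mul_le_mul_of_nonneg_left hupper hK))
  have : δ * (K + 1) = c := div_mul_cancel₀ _ (by positivity)
  nlinarith

/-- Dvoretsky–Rogers-type theorem, main implication. Let `T : P → E` be an isomorphism
onto its range. If there exist subspaces `R ⊆ G` and `S ⊆ F` with `P ⊆ S` such that
`R` is `B`-norming for `P`, the closed unit ball of `P` is `τ_B(R)`-sequentially
compact, the closed unit ball of `R` is `τ_B(S)`-compact, and `T` is `(q,R)`-summing
for some `1 ≤ q < ∞`, then `P` is finite-dimensional. -/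
theorem dvoretsky_rogers (B : F →L[ℝ] G →L[ℝ] X) (P : Submodule ℝ F)
    (T : P →L[ℝ] E) (c C : ℝ) (hc : 0 < c) (hcC : c ≤ C)
    (hiso : ∀ f : P, c * ‖f‖ ≤ ‖T f‖ ∧ ‖T f‖ ≤ C * ‖f‖)
    (h : ∃ (R : Submodule ℝ G) (S : Submodule ℝ F), P ≤ S ∧
      (∃ c' > 0, ∀ f ∈ P, c' * ‖f‖ ≤ sSup ((fun g => ‖B f g‖) '' subBall R)) ∧
      (∀ f : ℕ → P, (∃ M, ∀ n, ‖f n‖ ≤ M) → ∃ φ : ℕ → ℕ, StrictMono φ ∧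
        ∀ g ∈ R, CauchySeq (fun k => B ((f (φ k) : F)) g)) ∧
      (@IsCompact G (tauB B S) (subBall R)) ∧
      (∃ q : ℝ, 1 ≤ q ∧ ∃ K, 0 ≤ K ∧ IsSumming B P R q T K)) :
    FiniteDimensional ℝ P := by
  obtain ⟨R, S, hPS, -, hseq, hcomp, q, hq, K, hK, hT⟩ := h
  by_contra hfin
  obtain ⟨M, f, -, hfM, hfsep⟩ := exists_seq_norm_le_one_le_norm_sub (𝕜 := ℝ) hfin
  obtain ⟨φ, hφ, hcauchy⟩ := hseq f ⟨M, hfM⟩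
  let d : ℕ → P := fun k => f (φ (k + 1)) - f (φ k)
  have hd : ∀ k, ‖d k‖ ≤ M + M := fun k => norm_sub_le_of_le (hfM _) (hfM _)
  have hlim : ∀ g ∈ R, Filter.Tendsto (fun k => B (d k : F) g) Filter.atTop (nhds 0) := by
    intro g hg
    obtain ⟨x, hx⟩ := cauchySeq_tendsto_of_complete (hcauchy g hg)
    simpa [d] using (hx.comp (Filter.tendsto_add_atTop_nat 1)).sub hx
  obtain ⟨k, hk⟩ := hT.exists_norm_lt hq hK hPS hcomp hd hlim hc
  have hsep : 1 ≤ ‖d k‖ := hfsep (hφ (Nat.lt_succ_self k)).ne'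
  exact (((le_mul_iff_one_le_right hc).2 hsep).trans (hiso (d k)).1).not_gt hk
end
end

section
/- Assume that for every f ∈ F one has ‖f‖ = sup_{g ∈ G, ‖g‖ ≤ 1} ‖B(f, g)‖ (B is isometrically norming). Let P ⊆ F be a finite-dimensional subspace. Then there exists a finite-dimensional subspace R ⊆ G such that (1/4)·‖f‖ ≤ sup_{g ∈ R, ‖g‖ ≤ 1} ‖B(f, g)‖ ≤ ‖f‖ for every f ∈ P; in particular R is B-norming for P. -/
open scoped BigOperators

noncomputable section

variable {F G X : Type*}
variable [NormedAddCommGroup F] [NormedSpace ℝ F] [CompleteSpace F]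
variable [NormedAddCommGroup G] [NormedSpace ℝ G] [CompleteSpace G]
variable [NormedAddCommGroup X] [NormedSpace ℝ X] [CompleteSpace X]

/-- If `B : F × G → X` is isometrically norming, i.e.
`‖f‖ = sup_{‖g‖ ≤ 1} ‖B(f,g)‖` for every `f ∈ F`, then for every finite-dimensional
subspace `P ⊆ F` there is a finite-dimensional subspace `R ⊆ G` with
`(1/4)·‖f‖ ≤ sup_{g ∈ R, ‖g‖ ≤ 1} ‖B(f,g)‖ ≤ ‖f‖` for every `f ∈ P`; in particular
`R` is `B`-norming for `P`. -/
theorem finite_dimensional_dual_space (B : F →L[ℝ] G →L[ℝ] X)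
    (hnorm : ∀ f : F, ‖f‖ = sSup ((fun g => ‖B f g‖) '' {g : G | ‖g‖ ≤ 1}))
    (P : Submodule ℝ F) (hP : FiniteDimensional ℝ P) :
    ∃ R : Submodule ℝ G, FiniteDimensional ℝ R ∧
      ∀ f ∈ P, (1 / 4 : ℝ) * ‖f‖ ≤ sSup ((fun g => ‖B f g‖) '' subBall R) ∧
        sSup ((fun g => ‖B f g‖) '' subBall R) ≤ ‖f‖ := by
  have hbdd (f : F) : BddAbove ((fun g => ‖B f g‖) '' {g : G | ‖g‖ ≤ 1}) := by
    refine ⟨‖B f‖, ?_⟩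
    rintro _ ⟨g, hg, rfl⟩
    exact (B f).unit_le_opNorm g hg
  have hsub (R : Submodule ℝ G) : subBall R ⊆ {g : G | ‖g‖ ≤ 1} := fun g hg => hg.2
  have hcover : Metric.sphere (0 : P) 1 ⊆
      ⋃ g : {g : G // ‖g‖ ≤ 1}, {f : P | 1 / 4 < ‖B f g‖} := by
    intro f hf
    have hf1 : ‖(f : F)‖ = 1 := by simpa using hf
    have hlt : 1 / 4 < sSup ((fun g => ‖B f g‖) '' {g : G | ‖g‖ ≤ 1}) := by
      rw [← hnorm f, hf1]
      norm_num
    obtain ⟨_, ⟨g, hg, rfl⟩, h⟩ := exists_lt_of_lt_csSup (Set.Nonempty.image _ ⟨0, by simp⟩) hlt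
    exact Set.mem_iUnion.2 ⟨⟨g, hg⟩, h⟩
  have : ProperSpace P := FiniteDimensional.proper ℝ P
  obtain ⟨t, ht⟩ := (isCompact_sphere (0 : P) 1).elim_finite_subcover _
    (fun g => isOpen_lt continuous_const (by fun_prop)) hcover
  let R := Submodule.span ℝ ((↑) '' (t : Set {g : G // ‖g‖ ≤ 1}) : Set G)
  refine ⟨R, FiniteDimensional.span_of_finite ℝ (t.finite_toSet.image _), fun f hf => ⟨?_, ?_⟩⟩
  · rcases eq_or_ne f 0 with rfl | hf0
    · rw [norm_zero, mul_zero]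
      refine Real.sSup_nonneg ?_
      rintro _ ⟨g, -, rfl⟩
      exact norm_nonneg _
    have hpos : 0 < ‖f‖ := norm_pos_iff.2 hf0
    have hmem : ‖f‖⁻¹ • (⟨f, hf⟩ : P) ∈ Metric.sphere (0 : P) 1 := by
      simp [norm_smul, hpos.ne']
    obtain ⟨g, hgt, hg⟩ := Set.mem_iUnion₂.1 (ht hmem)
    have hg' : 1 / 4 < ‖f‖⁻¹ * ‖B f g‖ := by simpa [norm_smul] using hg
    rw [inv_mul_eq_div, lt_div_iff₀ hpos] at hg'
    exact hg'.le.trans <| le_csSup ((hbdd f).mono (Set.image_mono (hsub R)))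
      ⟨g, ⟨Submodule.subset_span ⟨g, hgt, rfl⟩, g.2⟩, rfl⟩
  · rw [hnorm f]
    exact csSup_le_csSup (hbdd f) (Set.Nonempty.image _ ⟨0, R.zero_mem, by simp⟩)
      (Set.image_mono (hsub R))
end
end

section
/- Let P ⊆ F be a finite-dimensional subspace and let R ⊆ G be a subspace that is B-norming for P with constant c > 0. Then every continuous linear operator T : P → E into a Banach space E is (1,R)-summing with respect to B, and consequently (q,R)-summing for every 1 ≤ q < ∞. -/
open scoped BigOperators

noncomputable section

variable {F G X E : Type*}
variable [NormedAddCommGroup F] [NormedSpace ℝ F] [CompleteSpace F]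
variable [NormedAddCommGroup G] [NormedSpace ℝ G] [CompleteSpace G]
variable [NormedAddCommGroup X] [NormedSpace ℝ X] [CompleteSpace X]
variable [NormedAddCommGroup E] [NormedSpace ℝ E] [CompleteSpace E]

/-- A subspace `R` that is norming for a finite-dimensional subspace `P` contains finitely many
elements of its unit ball that are already norming for `P`, up to a factor `2`. -/
theorem exists_finset_norming_s8 {V W Y : Type*} [NormedAddCommGroup V] [NormedSpace ℝ V]
    [NormedAddCommGroup W] [NormedSpace ℝ W] [NormedAddCommGroup Y] [NormedSpace ℝ Y]
    (B : V →L[ℝ] W →L[ℝ] Y) (P : Submodule ℝ V) (R : Submodule ℝ W) [FiniteDimensional ℝ P]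
    {c : ℝ} (hc : 0 < c)
    (hnorm : ∀ f ∈ P, c * ‖f‖ ≤ sSup ((fun g => ‖B f g‖) '' subBall R)) :
    ∃ s : Finset W, (∀ g ∈ s, g ∈ subBall R) ∧
      ∀ f : P, f ≠ 0 → ∃ g ∈ s, c / 2 * ‖f‖ ≤ ‖B (f : V) g‖ := by
  classical
  have : ProperSpace P := FiniteDimensional.proper ℝ P
  have hne : (subBall R).Nonempty := ⟨0, R.zero_mem, by simp⟩
  have hex : ∀ f ∈ Metric.sphere (0 : P) 1, ∃ g ∈ subBall R, c / 2 < ‖B (f : V) g‖ := by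
    intro f hf
    have hf1 : ‖(f : V)‖ = 1 := by simpa using hf
    have hlt : c / 2 < sSup ((fun g => ‖B (f : V) g‖) '' subBall R) := by
      have := hnorm f f.2
      rw [hf1] at this
      linarith
    obtain ⟨_, ⟨g, hg, rfl⟩, hlt⟩ := exists_lt_of_lt_csSup
      (hne.image _) hlt
    exact ⟨g, hg, hlt⟩
  choose! γ hγ hlt using hex
  obtain ⟨t, ht, hcover⟩ := (isCompact_sphere (0 : P) 1).elim_nhds_subcover
    (fun f => {x : P | c / 2 < ‖B (x : V) (γ f)‖}) (fun f hf =>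
      (isOpen_lt continuous_const (by fun_prop)).mem_nhds (hlt f hf))
  refine ⟨t.image γ, ?_, fun f hf => ?_⟩
  · simp only [Finset.mem_image]
    rintro _ ⟨f, hf, rfl⟩
    exact hγ f (ht f hf)
  · have hpos : 0 < ‖f‖ := norm_pos_iff.2 hf
    have hmem : ‖f‖⁻¹ • f ∈ Metric.sphere (0 : P) 1 := by
      rw [mem_sphere_zero_iff_norm, norm_smul, norm_inv, norm_norm, inv_mul_cancel₀ hpos.ne']
    obtain ⟨x, hx, hxf⟩ := Set.mem_iUnion₂.1 (hcover hmem)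
    refine ⟨γ x, Finset.mem_image_of_mem γ hx, ?_⟩
    have h : c / 2 < ‖f‖⁻¹ * ‖B (f : V) (γ x)‖ := by
      simpa [norm_smul] using hxf
    rw [inv_mul_eq_div, lt_div_iff₀ hpos] at h
    exact h.le

/-- The strong `q`-norms of a finite family, tested against the unit ball, are bounded above. -/
theorem bddAbove_strong_norm {V W Y : Type*} [NormedAddCommGroup V] [NormedSpace ℝ V]
    [NormedAddCommGroup W] [NormedSpace ℝ W] [NormedAddCommGroup Y] [NormedSpace ℝ Y]
    (B : V →L[ℝ] W →L[ℝ] Y) (R : Submodule ℝ W) {q : ℝ} (hq : 0 ≤ q)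
    {ι : Type*} [Fintype ι] (f : ι → V) :
    BddAbove ((fun g => (∑ i, ‖B (f i) g‖ ^ q) ^ (1 / q)) '' subBall R) := by
  refine ⟨(∑ i, ‖B (f i)‖ ^ q) ^ (1 / q), ?_⟩
  rintro _ ⟨g, hg, rfl⟩
  have (i : ι) : ‖B (f i) g‖ ≤ ‖B (f i)‖ := (B (f i)).unit_le_opNorm g hg.2
  dsimp only
  gcongr
  exact this _

/-- An operator on a finite-dimensional subspace is `(q,R)`-summing for every `q > 0` as soon as
`R` is norming. -/
theorem exists_isSumming_of_norming {V W Y Z : Type*}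
    [NormedAddCommGroup V] [NormedSpace ℝ V] [NormedAddCommGroup W] [NormedSpace ℝ W]
    [NormedAddCommGroup Y] [NormedSpace ℝ Y] [NormedAddCommGroup Z] [NormedSpace ℝ Z]
    (B : V →L[ℝ] W →L[ℝ] Y) (P : Submodule ℝ V) (R : Submodule ℝ W) [FiniteDimensional ℝ P] {c : ℝ} (hc : 0 < c)
    (hnorm : ∀ f ∈ P, c * ‖f‖ ≤ sSup ((fun g => ‖B f g‖) '' subBall R))
    (T : P →L[ℝ] Z) {q : ℝ} (hq : 0 < q) :
    ∃ K, 0 ≤ K ∧ IsSumming B P R q T K := by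
  obtain ⟨s, hs, hsn⟩ := exists_finset_norming_s8 B P R hc hnorm
  set C : ℝ := ‖T‖ * (2 / c) with hC
  have hC0 : 0 ≤ C := by positivity
  refine ⟨C * (s.card : ℝ) ^ (1 / q), by positivity, fun n f => ?_⟩
  set S := sSup ((fun g => (∑ i, ‖B (f i : V) g‖ ^ q) ^ (1 / q)) '' subBall R) with hS
  have hSle : ∀ g ∈ subBall R, (∑ i, ‖B (f i : V) g‖ ^ q) ^ (1 / q) ≤ S := fun g hg =>
    le_csSup (bddAbove_strong_norm B R hq.le fun i => (f i : V)) ⟨g, hg, rfl⟩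
  have hS0 : 0 ≤ S := le_trans (by positivity) (hSle 0 ⟨R.zero_mem, by simp⟩)
  have hpow : ∀ g ∈ s, ∑ i, ‖B (f i : V) g‖ ^ q ≤ S ^ q := fun g hg => by
    have h := hSle g (hs g hg)
    rwa [one_div, Real.rpow_inv_le_iff_of_pos (by positivity) hS0 hq] at h
  have hterm (x : P) : ‖T x‖ ^ q ≤ C ^ q * ∑ g ∈ s, ‖B (x : V) g‖ ^ q := by
    rcases eq_or_ne x 0 with rfl | hx
    · simp only [map_zero, norm_zero, Real.zero_rpow hq.ne']
      positivity
    · obtain ⟨g, hg, hle⟩ := hsn x hx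
      have h1 : ‖T x‖ ≤ C * ‖B (x : V) g‖ := calc
        ‖T x‖ ≤ ‖T‖ * ‖x‖ := T.le_opNorm x
        _ = C * (c / 2 * ‖x‖) := by rw [hC]; field_simp
        _ ≤ C * ‖B (x : V) g‖ := by gcongr
      calc ‖T x‖ ^ q ≤ (C * ‖B (x : V) g‖) ^ q := by gcongr
        _ = C ^ q * ‖B (x : V) g‖ ^ q := Real.mul_rpow hC0 (norm_nonneg _)
        _ ≤ C ^ q * ∑ g ∈ s, ‖B (x : V) g‖ ^ q := by
          gcongr
          exact Finset.single_le_sum (f := fun g => ‖B (x : V) g‖ ^ q)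
            (fun _ _ => by positivity) hg
  rw [one_div, Real.rpow_inv_le_iff_of_pos (by positivity) (by positivity) hq,
    Real.mul_rpow (by positivity) hS0, Real.mul_rpow hC0 (by positivity),
    Real.rpow_inv_rpow (by positivity) hq.ne']
  calc ∑ i, ‖T (f i)‖ ^ q ≤ ∑ i, C ^ q * ∑ g ∈ s, ‖B (f i : V) g‖ ^ q :=
        Finset.sum_le_sum fun i _ => hterm (f i)
    _ = C ^ q * ∑ g ∈ s, ∑ i, ‖B (f i : V) g‖ ^ q := by
        rw [← Finset.mul_sum, Finset.sum_comm]
    _ ≤ C ^ q * (s.card • S ^ q) := by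
        gcongr
        exact Finset.sum_le_card_nsmul s _ _ hpow
    _ = C ^ q * s.card * S ^ q := by rw [nsmul_eq_mul, mul_assoc]

/-- If `P ⊆ F` is finite-dimensional and `R ⊆ G` is `B`-norming for `P` with constant
`c > 0`, then every continuous linear operator `T : P → E` into a Banach space `E` is
`(1,R)`-summing with respect to `B`, and consequently `(q,R)`-summing for every
`1 ≤ q < ∞`. -/
theorem finite_dimensional_summing (B : F →L[ℝ] G →L[ℝ] X) (P : Submodule ℝ F)
    (R : Submodule ℝ G) (hP : FiniteDimensional ℝ P) (c : ℝ) (hc : 0 < c)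
    (hnorm : ∀ f ∈ P, c * ‖f‖ ≤ sSup ((fun g => ‖B f g‖) '' subBall R))
    (T : P →L[ℝ] E) :
    (∃ K, 0 ≤ K ∧ IsSumming B P R 1 T K) ∧
      ∀ q : ℝ, 1 ≤ q → ∃ K, 0 ≤ K ∧ IsSumming B P R q T K := by
  exact ⟨exists_isSumming_of_norming B P R hc hnorm T one_pos, fun q hq =>
    exists_isSumming_of_norming B P R hc hnorm T (one_pos.trans_le hq)⟩
end
end

section
/- Let g₀ ∈ G and let I : F → X be the continuous linear operator I(f) = B(f, g₀). Let P ⊆ F be a subspace on which I is an isomorphism into, i.e. there is c > 0 with c‖f‖ ≤ ‖B(f, g₀)‖ for all f ∈ P. Suppose there exist subspaces R ⊆ G with g₀ ∈ R and S ⊆ F with P ⊆ S such that: R is B-norming for P with some constant; the closed unit ball of P is τ_B(R)-sequentially compact, i.e. every norm-bounded sequence (f_n) in P has a subsequence (f_{n_k}) such that (B(f_{n_k}, g))_k is Cauchy in X for every g ∈ R; and the closed unit ball of R is compact in the topology τ_B(S). Then P is finite-dimensional. -/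
open scoped BigOperators

noncomputable section

variable {F G X : Type*}
variable [NormedAddCommGroup F] [NormedSpace ℝ F] [CompleteSpace F]
variable [NormedAddCommGroup G] [NormedSpace ℝ G] [CompleteSpace G]
variable [NormedAddCommGroup X] [NormedSpace ℝ X] [CompleteSpace X]

/-- Let `I : F → X`, `I(f) = B(f, g₀)`, and let `P ⊆ F` be a subspace on which `I` is an
isomorphism into (`c‖f‖ ≤ ‖B(f,g₀)‖` on `P`). If there are subspaces `R ⊆ G` with
`g₀ ∈ R` and `S ⊆ F` with `P ⊆ S` such that `R` is `B`-norming for `P`, the closed unit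
ball of `P` is `τ_B(R)`-sequentially compact, and the closed unit ball of `R` is
`τ_B(S)`-compact, then `P` is finite-dimensional. -/
theorem fixed_by_integration_finite_dimensional (B : F →L[ℝ] G →L[ℝ] X)
    (P : Submodule ℝ F) (g₀ : G) (c : ℝ) (hc : 0 < c)
    (hiso : ∀ f ∈ P, c * ‖f‖ ≤ ‖B f g₀‖)
    (h : ∃ (R : Submodule ℝ G) (S : Submodule ℝ F), g₀ ∈ R ∧ P ≤ S ∧
      (∃ c' > 0, ∀ f ∈ P, c' * ‖f‖ ≤ sSup ((fun g => ‖B f g‖) '' subBall R)) ∧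
      (∀ f : ℕ → P, (∃ M, ∀ n, ‖f n‖ ≤ M) → ∃ φ : ℕ → ℕ, StrictMono φ ∧
        ∀ g ∈ R, CauchySeq (fun k => B ((f (φ k) : F)) g)) ∧
      @IsCompact G (tauB B S) (subBall R)) :
    FiniteDimensional ℝ P := by
  obtain ⟨R, _, hg₀, _, _, hcomp, _⟩ := h
  by_contra hP
  obtain ⟨M, f, _, hM, hsep⟩ := exists_seq_norm_le_one_le_norm_sub (𝕜 := ℝ) (E := P) hP
  obtain ⟨φ, hφ, hcauchy⟩ := hcomp f ⟨M, hM⟩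
  obtain ⟨N, hN⟩ := Metric.cauchySeq_iff.1 (hcauchy g₀ hg₀) c hc
  have hclose := hN N le_rfl (N + 1) N.le_succ
  rw [dist_eq_norm, ← sub_apply, ← map_sub] at hclose
  have hiso' := hiso _ (f (φ N) - f (φ (N + 1))).2
  have hfar : 1 ≤ ‖(f (φ N) - f (φ (N + 1)) : P)‖ :=
    hsep (hφ.injective.ne N.succ_ne_self.symm)
  rw [← Submodule.coe_sub] at hclose
  rw [Submodule.coe_norm] at hfar
  nlinarith
end
end

section
/- Let P ⊆ F and R ⊆ G be subspaces and let g₀ ∈ R be such that there is a constant c > 0 with ‖f‖ ≤ c·‖B(f, g₀)‖ for every f ∈ P. Then for every Banach space E, every continuous linear operator T : P → E is (q,R)-summing with respect to B for every 1 ≤ q < ∞. -/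
open scoped BigOperators

noncomputable section

variable {F G X E : Type*}
variable [NormedAddCommGroup F] [NormedSpace ℝ F] [CompleteSpace F]
variable [NormedAddCommGroup G] [NormedSpace ℝ G] [CompleteSpace G]
variable [NormedAddCommGroup X] [NormedSpace ℝ X] [CompleteSpace X]
variable [NormedAddCommGroup E] [NormedSpace ℝ E] [CompleteSpace E]

/-- The `ℓ^q` norm of a finite family is monotone and positively homogeneous. -/
theorem rpow_sum_rpow_le_mul {ι : Type*} (s : Finset ι) {a b : ι → ℝ} {K q : ℝ} (hK : 0 ≤ K)
    (hq : 0 < q) (ha : ∀ i, 0 ≤ a i) (hb : ∀ i, 0 ≤ b i) (hab : ∀ i, a i ≤ K * b i) :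
    (∑ i ∈ s, a i ^ q) ^ (1 / q) ≤ K * (∑ i ∈ s, b i ^ q) ^ (1 / q) := by
  have hsum : ∑ i ∈ s, a i ^ q ≤ K ^ q * ∑ i ∈ s, b i ^ q := by
    rw [Finset.mul_sum]
    refine Finset.sum_le_sum fun i _ => ?_
    rw [← Real.mul_rpow hK (hb i)]
    exact Real.rpow_le_rpow (ha i) (hab i) hq.le
  calc (∑ i ∈ s, a i ^ q) ^ (1 / q)
      ≤ (K ^ q * ∑ i ∈ s, b i ^ q) ^ (1 / q) :=
        Real.rpow_le_rpow (Finset.sum_nonneg fun i _ => Real.rpow_nonneg (ha i) q) hsum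
          (by positivity)
    _ = K * (∑ i ∈ s, b i ^ q) ^ (1 / q) := by
        rw [Real.mul_rpow (Real.rpow_nonneg hK q)
          (Finset.sum_nonneg fun i _ => Real.rpow_nonneg (hb i) q), one_div,
          Real.rpow_rpow_inv hK hq.ne']

/-- The weak `q`-norms of a finite family are bounded on the unit ball of `R`. -/
theorem bddAbove_image_subBall {F G X : Type*} [NormedAddCommGroup F] [NormedSpace ℝ F]
    [NormedAddCommGroup G] [NormedSpace ℝ G] [NormedAddCommGroup X] [NormedSpace ℝ X]
    (B : F →L[ℝ] G →L[ℝ] X) (R : Submodule ℝ G) {q : ℝ} (hq : 0 < q)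
    {ι : Type*} [Fintype ι] (f : ι → F) :
    BddAbove ((fun g => (∑ i, ‖B (f i) g‖ ^ q) ^ (1 / q)) '' subBall R) := by
  refine ⟨1 * (∑ i, ‖B (f i)‖ ^ q) ^ (1 / q), ?_⟩
  rintro _ ⟨g, ⟨-, hg⟩, rfl⟩
  refine rpow_sum_rpow_le_mul _ zero_le_one hq (fun _ => norm_nonneg _)
    (fun _ => norm_nonneg _) fun i => ?_
  rw [one_mul]
  exact (B (f i)).unit_le_opNorm g hg

/-- If `g₀ ∈ R` and `‖f‖ ≤ c·‖B(f,g₀)‖` on a subspace `P ⊆ F` (i.e. `P` is fixed by the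
map `f ↦ B(f,g₀)`), then every continuous linear operator `T : P → E` into a Banach
space `E` is `(q,R)`-summing with respect to `B` for every `1 ≤ q < ∞`. -/
theorem fixed_subspace_all_operators_summing (B : F →L[ℝ] G →L[ℝ] X)
    (P : Submodule ℝ F) (R : Submodule ℝ G) (g₀ : G) (hg₀ : g₀ ∈ R)
    (c : ℝ) (hc : 0 < c) (hfix : ∀ f ∈ P, ‖f‖ ≤ c * ‖B f g₀‖)
    (T : P →L[ℝ] E) :
    ∀ q : ℝ, 1 ≤ q → ∃ K, 0 ≤ K ∧ IsSumming B P R q T K := by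
  intro q hq
  have hq' : 0 < q := zero_lt_one.trans_le hq
  set r : ℝ := ‖g₀‖ + 1 with hr
  have hr0 : 0 < r := by positivity
  have hK : 0 ≤ ‖T‖ * (c * r) := by positivity
  refine ⟨‖T‖ * (c * r), hK, fun n f => ?_⟩
  have hball : r⁻¹ • g₀ ∈ subBall R := by
    refine ⟨R.smul_mem _ hg₀, ?_⟩
    rw [norm_smul, norm_inv, Real.norm_of_nonneg hr0.le, inv_mul_le_one₀ hr0]
    linarith
  have hT : ∀ i, ‖T (f i)‖ ≤ ‖T‖ * (c * r) * ‖B (f i : F) (r⁻¹ • g₀)‖ := fun i => by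
    have hB : c * r * ‖B (f i : F) (r⁻¹ • g₀)‖ = c * ‖B (f i : F) g₀‖ := by
      rw [map_smul, norm_smul, norm_inv, Real.norm_of_nonneg hr0.le]
      field_simp
    rw [mul_assoc, hB]
    exact (T.le_opNorm (f i)).trans
      (mul_le_mul_of_nonneg_left (hfix _ (f i).2) (norm_nonneg T))
  refine (rpow_sum_rpow_le_mul _ hK hq' (fun _ => norm_nonneg _)
    (fun _ => norm_nonneg _) hT).trans (mul_le_mul_of_nonneg_left ?_ hK)
  exact le_csSup (bddAbove_image_subBall B R hq' fun i => (f i : F)) ⟨_, hball, rfl⟩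
end
end

section
/- Let P ⊆ F and R ⊆ G be subspaces such that R is B-norming for P with constant c > 0 and the closed unit ball of P is compact in the topology τ_B(R). Then on every norm-bounded subset A of P the topology τ_B(R) coincides with the weaker topology τ_{w,B}(R) generated by the seminorms f ↦ |⟨x*, B(f, g)⟩| for g ∈ R and x* in the continuous dual X* of X. -/
open scoped BigOperators

noncomputable section

variable {F G X : Type*}
variable [NormedAddCommGroup F] [NormedSpace ℝ F] [CompleteSpace F]
variable [NormedAddCommGroup G] [NormedSpace ℝ G] [CompleteSpace G]
variable [NormedAddCommGroup X] [NormedSpace ℝ X] [CompleteSpace X]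

/-- `τ_B(R)`: the locally convex topology on `F` generated by the seminorms
`f ↦ ‖B(f,g)‖` for `g ∈ R`. -/
def tauB' (B : F →L[ℝ] G →L[ℝ] X) (R : Submodule ℝ G) : TopologicalSpace F :=
  TopologicalSpace.induced (fun f => fun g : R => B f (g : G)) inferInstance

/-- `τ_{w,B}(R)`: the locally convex topology on `F` generated by the seminorms
`f ↦ |⟨x*, B(f,g)⟩|` for `g ∈ R` and `x*` in the continuous dual of `X`. -/
def tauWB (B : F →L[ℝ] G →L[ℝ] X) (R : Submodule ℝ G) : TopologicalSpace F :=
  TopologicalSpace.induced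
    (fun f => fun p : R × (X →L[ℝ] ℝ) => p.2 (B f (p.1 : G))) inferInstance

/-- A continuous injection into a Hausdorff space induces the given topology through any map whose
range lies in a compact set. -/
theorem induced_comp_eq_of_mapsTo_isCompact {S Y Z : Type*} [TopologicalSpace Y]
    [tZ : TopologicalSpace Z] [T2Space Z] {K : Set Y} (hK : IsCompact K) {ψ : Y → Z}
    (hψ : Continuous ψ) (hinj : Function.Injective ψ) {φ : S → Y} (hφ : ∀ s, φ s ∈ K) :
    TopologicalSpace.induced φ inferInstance = TopologicalSpace.induced (ψ ∘ φ) tZ := by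
  have : CompactSpace K := isCompact_iff_compactSpace.mp hK
  have hind : Topology.IsInducing (ψ ∘ (Subtype.val : K → Y)) :=
    ((hψ.comp continuous_subtype_val).isClosedEmbedding
      (hinj.comp Subtype.val_injective)).isInducing
  have h := congrArg (TopologicalSpace.induced (Set.codRestrict φ K hφ)) hind.eq_induced
  rw [instTopologicalSpaceSubtype, induced_compose, induced_compose] at h
  exact h

/-- If `R ⊆ G` is `B`-norming for `P ⊆ F` with constant `c > 0` and the closed unit ball
of `P` is `τ_B(R)`-compact, then on every norm-bounded subset `A` of `P` the topology
`τ_B(R)` coincides with the weaker topology `τ_{w,B}(R)`. -/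
theorem tauB_eq_tauWB_on_bounded (B : F →L[ℝ] G →L[ℝ] X) (P : Submodule ℝ F)
    (R : Submodule ℝ G) (c : ℝ) (hc : 0 < c)
    (hnorm : ∀ f ∈ P, c * ‖f‖ ≤ sSup ((fun g => ‖B f g‖) '' subBall R))
    (hPcomp : @IsCompact F (tauB' B R) (subBall P)) :
    ∀ A : Set F, A ⊆ (P : Set F) → (∃ C, ∀ f ∈ A, ‖f‖ ≤ C) →
      TopologicalSpace.induced (Subtype.val : A → F) (tauB' B R) =
        TopologicalSpace.induced (Subtype.val : A → F) (tauWB B R) := by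
  intro A hA ⟨C, hC⟩
  let Φ : F → R → X := fun f g => B f (g : G)
  let ψ : (R → X) → R × (X →L[ℝ] ℝ) → ℝ := fun u p => p.2 (u p.1)
  have hψ : Continuous ψ :=
    continuous_pi fun p => p.2.continuous.comp (continuous_apply p.1)
  have hinj : Function.Injective ψ := fun u v huv => funext fun g =>
    (SeparatingDual.eq_iff_forall_dual_eq (R := ℝ)).2 fun x => congrFun huv (g, x)
  have hΦ : IsCompact (Φ '' subBall P) :=
    @IsCompact.image F (R → X) (tauB' B R) _ _ Φ hPcomp continuous_induced_dom
  have hscale : IsCompact ((fun u : R → X => max C 1 • u) '' (Φ '' subBall P)) :=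
    hΦ.image (continuous_const_smul _)
  have hM : 0 < max C 1 := lt_max_of_lt_right one_pos
  have hmem (f : A) : (Φ ∘ Subtype.val) f ∈
      (fun u : R → X => max C 1 • u) '' (Φ '' subBall P) := by
    refine ⟨_, ⟨(max C 1)⁻¹ • (f : F), ⟨P.smul_mem _ (hA f.2), ?_⟩, rfl⟩, ?_⟩
    · rw [norm_smul, norm_inv, Real.norm_of_nonneg hM.le, inv_mul_le_one₀ hM]
      exact (hC f f.2).trans (le_max_left _ _)
    · funext g
      simp [Φ, smul_smul, mul_inv_cancel₀ hM.ne']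
  rw [tauB', tauWB, induced_compose, induced_compose]
  exact induced_comp_eq_of_mapsTo_isCompact hscale hψ hinj hmem
end
end

section
/- Let B : ℓ⁴ × ℓ⁴ → ℓ² be the continuous bilinear map B(λ, τ) = (λ_n τ_n)_n. For the standard unit vectors e_1, …, e_k of ℓ⁴ and any 1 ≤ q < ∞ one has Σ_{i=1}^k ‖e_i‖_{ℓ⁴}^q = k while sup_{τ ∈ ℓ⁴, ‖τ‖_{ℓ⁴} ≤ 1} Σ_{i=1}^k ‖B(e_i, τ)‖_{ℓ²}^q ≤ k^{3/4}. Consequently, for no 1 ≤ q < ∞ does there exist a constant K ≥ 0 such that (Σ_{i=1}^n ‖λ^i‖_{ℓ⁴}^q)^{1/q} ≤ K · sup_{τ ∈ ℓ⁴, ‖τ‖_{ℓ⁴} ≤ 1} (Σ_{i=1}^n ‖B(λ^i, τ)‖_{ℓ²}^q)^{1/q} for all finite families λ¹, …, λⁿ ∈ ℓ⁴; that is, the identity map on ℓ⁴ is not (q, ℓ⁴)-summing with respect to B for any 1 ≤ q < ∞. -/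
open scoped BigOperators

noncomputable section

instance : Fact ((1 : ENNReal) ≤ 4) := ⟨by norm_num⟩
instance : Fact ((1 : ENNReal) ≤ 2) := ⟨by norm_num⟩

/-- A finite sum of absolute values of entries of a point of the unit ball of `ℓ⁴` obeys the
power mean bound, also after raising the entries to a power at least one. -/
theorem sum_norm_rpow_le_of_norm_le_one {q : ℝ} (hq : 1 ≤ q)
    {τ : lp (fun _ : ℕ => ℝ) 4} (hτ : ‖τ‖ ≤ 1) (k : ℕ) :
    ∑ i ∈ Finset.range k, ‖τ i‖ ^ q ≤ (k : ℝ) ^ ((3 : ℝ) / 4) := by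
  have hentry (i : ℕ) : ‖τ i‖ ≤ 1 := (lp.norm_apply_le_norm (by norm_num) τ i).trans hτ
  have hsum : ∑ i ∈ Finset.range k, ‖τ i‖ ^ 4 ≤ 1 := by
    have h := lp.sum_rpow_le_norm_rpow (p := 4) (by norm_num) τ (Finset.range k)
    norm_num at h
    simpa using h.trans (pow_le_one₀ (norm_nonneg _) hτ)
  have hpow : (∑ i ∈ Finset.range k, ‖τ i‖) ^ 4 ≤ (k : ℝ) ^ 3 := by
    have h := Real.rpow_sum_le_const_mul_sum_rpow (Finset.range k) (fun i => τ i)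
      (p := 4) (by norm_num)
    norm_num at h
    simpa using h.trans (mul_le_of_le_one_right (by positivity) (by simpa using hsum))
  calc ∑ i ∈ Finset.range k, ‖τ i‖ ^ q ≤ ∑ i ∈ Finset.range k, ‖τ i‖ :=
        Finset.sum_le_sum fun i _ =>
          Real.rpow_le_self_of_le_one (norm_nonneg _) (hentry i) hq
    _ ≤ (k : ℝ) ^ ((3 : ℝ) / 4) := by
        refine le_of_pow_le_pow_left₀ four_ne_zero (by positivity) (hpow.trans_eq ?_)
        rw [← Real.rpow_natCast (_ ^ _) 4, ← Real.rpow_mul k.cast_nonneg, ← Real.rpow_natCast]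
        norm_num

/-- Multiplying a standard unit vector into `τ` leaves a vector of norm `‖τ i‖`. -/
theorem norm_single_mul_eq
    {Bm : lp (fun _ : ℕ => ℝ) 4 →L[ℝ] lp (fun _ : ℕ => ℝ) 4 →L[ℝ] lp (fun _ : ℕ => ℝ) 2}
    (hBm : ∀ (a b : lp (fun _ : ℕ => ℝ) 4) (n : ℕ), (Bm a b) n = a n * b n)
    (τ : lp (fun _ : ℕ => ℝ) 4) (i : ℕ) :
    ‖Bm (lp.single 4 i (1 : ℝ)) τ‖ = ‖τ i‖ := by
  have h : Bm (lp.single 4 i (1 : ℝ)) τ = lp.single 2 i (τ i) := by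
    ext n
    rw [hBm]
    obtain rfl | hn := eq_or_ne n i
    · simp
    · simp [hn]
  rw [h, lp.norm_single (by norm_num)]

/-- The identity map on `ℓ⁴` is not `(q, ℓ⁴)`-summing with respect to the pointwise
product bilinear map `B : ℓ⁴ × ℓ⁴ → ℓ²`, `B(λ,τ) = (λ_n τ_n)_n`, for any `1 ≤ q < ∞`:
for the standard unit vectors `e_1, …, e_k` of `ℓ⁴` one has `Σ_{i<k} ‖e_i‖^q = k` while
`sup_{‖τ‖ ≤ 1} Σ_{i<k} ‖B(e_i,τ)‖^q ≤ k^{3/4}`, and consequently no constant `K ≥ 0`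
satisfies the `(q, ℓ⁴)`-summing inequality for the identity. -/
theorem identity_not_summing_l4
    (Bm : lp (fun _ : ℕ => ℝ) 4 →L[ℝ] lp (fun _ : ℕ => ℝ) 4 →L[ℝ] lp (fun _ : ℕ => ℝ) 2)
    (hBm : ∀ (a b : lp (fun _ : ℕ => ℝ) 4) (n : ℕ), (Bm a b) n = a n * b n)
    (q : ℝ) (hq : 1 ≤ q) :
    (∀ k : ℕ,
      (∑ i ∈ Finset.range k, ‖(lp.single 4 i (1 : ℝ) : lp (fun _ : ℕ => ℝ) 4)‖ ^ q)
        = (k : ℝ) ∧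
      sSup {s : ℝ | ∃ τ : lp (fun _ : ℕ => ℝ) 4, ‖τ‖ ≤ 1 ∧
          s = ∑ i ∈ Finset.range k, ‖Bm (lp.single 4 i (1 : ℝ)) τ‖ ^ q}
        ≤ (k : ℝ) ^ ((3 : ℝ) / 4)) ∧
    ¬ ∃ K : ℝ, 0 ≤ K ∧ ∀ (n : ℕ) (f : Fin n → lp (fun _ : ℕ => ℝ) 4),
      (∑ i, ‖f i‖ ^ q) ^ (1 / q) ≤
        K * sSup {s : ℝ | ∃ τ : lp (fun _ : ℕ => ℝ) 4, ‖τ‖ ≤ 1 ∧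
          s = (∑ i, ‖Bm (f i) τ‖ ^ q) ^ (1 / q)} := by
  have hunit (i : ℕ) : ‖(lp.single 4 i (1 : ℝ) : lp (fun _ : ℕ => ℝ) 4)‖ = 1 := by
    rw [lp.norm_single (by norm_num), norm_one]
  have hbound (k : ℕ) (τ : lp (fun _ : ℕ => ℝ) 4) (hτ : ‖τ‖ ≤ 1) :
      ∑ i ∈ Finset.range k, ‖Bm (lp.single 4 i (1 : ℝ)) τ‖ ^ q ≤ (k : ℝ) ^ ((3 : ℝ) / 4) := by
    simp only [norm_single_mul_eq hBm]
    exact sum_norm_rpow_le_of_norm_le_one hq hτ k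
  have hq0 : 0 < q := by linarith
  refine ⟨fun k => ⟨by simp [hunit], Real.sSup_le ?_ (by positivity)⟩, ?_⟩
  · rintro s ⟨τ, hτ, rfl⟩
    exact hbound k τ hτ
  rintro ⟨K, hK, h⟩
  obtain ⟨m, hm⟩ := exists_nat_gt (K ^ q)
  have hm0 : (0 : ℝ) < m := (Real.rpow_nonneg hK q).trans_lt hm
  have hsup := h (m ^ 4) fun i => lp.single 4 (i : ℕ) (1 : ℝ)
  have hle : (((m ^ 4 : ℕ) : ℝ)) ^ (1 / q) ≤ K * ((m : ℝ) ^ 3) ^ (1 / q) := by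
    calc (((m ^ 4 : ℕ) : ℝ)) ^ (1 / q)
        = (∑ i : Fin (m ^ 4),
            ‖(lp.single 4 (i : ℕ) (1 : ℝ) : lp (fun _ : ℕ => ℝ) 4)‖ ^ q) ^ (1 / q) := by
          simp [hunit]
      _ ≤ _ := hsup
      _ ≤ _ := by
          refine mul_le_mul_of_nonneg_left (Real.sSup_le ?_ (by positivity)) hK
          rintro s ⟨τ, hτ, rfl⟩
          refine Real.rpow_le_rpow (by positivity) ?_ (by positivity)
          rw [Fin.sum_univ_eq_sum_range fun i => ‖Bm (lp.single 4 i (1 : ℝ)) τ‖ ^ q]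
          refine (hbound _ τ hτ).trans_eq ?_
          rw [Nat.cast_pow, ← Real.rpow_natCast, ← Real.rpow_mul hm0.le, ← Real.rpow_natCast]
          norm_num
  have hpow := Real.rpow_le_rpow (by positivity) hle hq0.le
  rw [Real.mul_rpow hK (by positivity), ← Real.rpow_mul (by positivity),
    ← Real.rpow_mul (by positivity), one_div_mul_cancel hq0.ne', Real.rpow_one, Real.rpow_one,
    Nat.cast_pow] at hpow
  have hlt := mul_lt_mul_of_pos_right hm (pow_pos hm0 3)
  linarith [pow_succ' (m : ℝ) 3]
end
end
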